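/- Suppose b satisfies Assumption 1 with ρ ∈ (1,2), adopt the spectral setup and the finite element setup, and assume the Ritz projection error bound holds. Then for every ε > 0 and T > 0 there exists C = C(T,ε) > 0 such that for every s with 0 ≤ s ≤ 2, every t ∈ [0,T], and every x with ‖x‖_{s(1+ε)} < ∞: ‖S(t)x − S_h(t)P_h x‖ ≤ C h^{s} ‖x‖_{s(1+ε)}. -/

import Mathlib

open MeasureTheory Filter Set
open scoped ENNReal NNReal RealInnerProductSpace

noncomputable section

/-- The Laplace transform `b̂(z) = ∫₀^∞ e^{-zt} b(t) dt` of a real-valued kernel `b`. -/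
def laplaceTransform (b : ℝ → ℝ) (z : ℂ) : ℂ :=
  ∫ t in Set.Ioi (0 : ℝ), Complex.exp (-z * t) * (b t : ℂ)

/-- Assumption 1: `b` is a nonzero, locally integrable, 3-monotone kernel
(with derivative `b'` on `(0,∞)`), `b(t) → 0` as `t → ∞`, and the angle condition
`ρ = 1 + (2/π) sup{|arg b̂(λ)| : Re λ > 0} ∈ (1,2)` holds. -/
structure Assumption1 (b b' : ℝ → ℝ) (ρ : ℝ) : Prop where
  locInt : ∀ T > 0, IntegrableOn b (Set.Ioc 0 T)
  ne_zero : ∃ t > 0, b t ≠ 0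
  nonneg : ∀ t > 0, 0 ≤ b t
  anti : AntitoneOn b (Set.Ioi 0)
  cvx : ConvexOn ℝ (Set.Ioi 0) b
  hasDeriv : ∀ t > 0, HasDerivAt b (b' t) t
  deriv_nonpos : ∀ t > 0, b' t ≤ 0
  deriv_anti : AntitoneOn (fun t => -(b' t)) (Set.Ioi 0)
  deriv_cvx : ConvexOn ℝ (Set.Ioi 0) (fun t => -(b' t))
  tendsto_zero : Tendsto b atTop (nhds 0)
  rho_eq : ρ = 1 + (2 / Real.pi) *
      sSup {θ : ℝ | ∃ z : ℂ, 0 < z.re ∧ θ = |(laplaceTransform b z).arg|}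
  rho_mem : ρ ∈ Set.Ioo (1 : ℝ) 2

/-- Assumption 2: `b̂` extends analytically to a sector `Σ_θ`, `θ > π/2`, with the
bounds `|b̂^{(k)}(z)| ≤ C |z|^{1-ρ-k}`, `k = 0,1`, there. -/
structure Assumption2 (b : ℝ → ℝ) (ρ θ : ℝ) : Prop where
  theta_gt : Real.pi / 2 < θ
  holo : ∃ B : ℂ → ℂ,
    (∀ z : ℂ, z ≠ 0 → |z.arg| < θ → DifferentiableAt ℂ B z) ∧
    (∀ z : ℂ, 0 < z.re → B z = laplaceTransform b z) ∧
    ∃ C > 0, (∀ z : ℂ, z ≠ 0 → |z.arg| < θ → ‖B z‖ ≤ C * ‖z‖ ^ (1 - ρ)) ∧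
      (∀ z : ℂ, z ≠ 0 → |z.arg| < θ → ‖deriv B z‖ ≤ C * ‖z‖ ^ (-ρ))

/-- `s` (with derivative `s'` on `(0,∞)`) solves the scalar Volterra equation
`s'(t) + λ ∫₀ᵗ b(t-u) s(u) du = 0`, `s(0) = 1`. -/
structure IsScalarSolution (b : ℝ → ℝ) (lam : ℝ) (s s' : ℝ → ℝ) : Prop where
  init : s 0 = 1
  cont : ContinuousOn s (Set.Ici 0)
  hasDeriv : ∀ t > 0, HasDerivAt s (s' t) t
  eqn : ∀ t > 0, s' t + lam * ∫ u in (0 : ℝ)..t, b (t - u) * s u = 0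

/-- The resolvent family `S(t)x = Σ_k s_k(t) (x,e_k) e_k`. -/
def Sop {H : Type*} [NormedAddCommGroup H] [InnerProductSpace ℝ H]
    (e : HilbertBasis ℕ ℝ H) (s : ℕ → ℝ → ℝ) (t : ℝ) (x : H) : H :=
  ∑' k, (s k t * ⟪x, e k⟫) • (e k : H)

/-- The Backward Euler convolution quadrature operator
`B_k = ∫₀^∞ F(Δt s) e^{-s} s^{k-1}/(k-1)! ds`. -/
def quadB {H : Type*} [NormedAddCommGroup H] [NormedSpace ℝ H]
    (Δt : ℝ) (F : ℝ → H) (k : ℕ) : H :=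
  ∫ u in Set.Ioi (0 : ℝ),
    (Real.exp (-u) * u ^ (k - 1) / (Nat.factorial (k - 1) : ℝ)) • F (Δt * u)

/-- The finite element setup: `f` is an orthonormal basis of the finite dimensional
subspace `V_h ⊆ D(A^{1/2})`, consisting of eigenvectors of the discrete operator `A_h`
(defined via the bilinear form `a(u,v) = Σ_k λ_k (u,e_k)(v,e_k)`) with positive
eigenvalues `μ`. -/
structure FESetup {H : Type*} [NormedAddCommGroup H] [InnerProductSpace ℝ H]
    (e : HilbertBasis ℕ ℝ H) (lam : ℕ → ℝ) (N : ℕ) (f : Fin N → H) (μ : Fin N → ℝ) :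
    Prop where
  f_orth : Orthonormal ℝ f
  mu_pos : ∀ j, 0 < μ j
  f_dom : ∀ j, (∑' k, ENNReal.ofReal (lam k * ⟪f j, e k⟫ ^ 2)) < ⊤
  eigen : ∀ j j', (∑' k, lam k * ⟪f j, e k⟫ * ⟪f j', e k⟫) = μ j * ⟪f j, f j'⟫

/-- A 3-monotone kernel vanishing at infinity is a positive superposition of the tent
functions `t ↦ (y - t)₊`. -/
theorem Assumption1.exists_density {b b' : ℝ → ℝ} {ρ : ℝ} (hb : Assumption1 b b' ρ) :
    ∃ α : ℝ → ℝ, Measurable α ∧ (∀ y, 0 ≤ α y) ∧ ∀ t > 0,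
      IntegrableOn (fun y => (y - t) * α y) (Ioi t) ∧ b t = ∫ y in Ioi t, (y - t) * α y := by
  set a : ℝ → ℝ := fun t => -(b' t) with ha
  have hint : interior (Ioi (0 : ℝ)) = Ioi 0 := interior_Ioi
  have hmeas : Measurable (fun y : ℝ => derivWithin a (Ioi y) y) := measurable_derivWithin_Ioi a
  set α : ℝ → ℝ := fun y => -derivWithin a (Ioi y) y with hα
  have hαnn : ∀ y > 0, 0 ≤ α y := by
    intro y hy
    have h1 := hb.deriv_cvx.rightDeriv_le_slope_of_mem_interior (x := y) (y := y + 1)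
      (by rw [hint]; exact hy) (by show (0 : ℝ) < y + 1; linarith) (by linarith)
    have h2 : a (y + 1) ≤ a y := hb.deriv_anti hy (by show (0 : ℝ) < y + 1; linarith) (by linarith)
    have h3 : slope a y (y + 1) ≤ 0 := by
      simp only [slope_def_field]
      apply div_nonpos_of_nonpos_of_nonneg <;> linarith
    change derivWithin a (Ioi y) y ≤ slope a y (y + 1) at h1
    simp only [hα]; linarith
  refine ⟨(Ioi (0 : ℝ)).indicator α, hmeas.neg.indicator measurableSet_Ioi,
    indicator_nonneg fun y hy => hαnn y hy, ?_⟩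
  intro t ht
  set F : ℝ → ℝ := fun y => -(b y + (y - t) * a y) with hF
  have hder : ∀ x ∈ Ioi (0 : ℝ), HasDerivWithinAt F ((x - t) * α x) (Ioi x) x := by
    intro x hx
    have h1 : HasDerivWithinAt a (derivWithin a (Ioi x) x) (Ioi x) x :=
      hb.deriv_cvx.hasDerivWithinAt_rightDeriv_of_mem_interior (by rw [hint]; exact hx)
    have h2 := ((hb.hasDeriv x hx).hasDerivWithinAt (s := Ioi x)).add
      ((((hasDerivAt_id x).sub_const t).hasDerivWithinAt (s := Ioi x)).mul h1)
    refine h2.neg.congr_deriv ?_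
    simp only [hα, ha, id]; ring
  have hacont : ContinuousOn a (Ioi 0) := hb.deriv_cvx.continuousOn isOpen_Ioi
  have hbcont : ContinuousOn b (Ioi 0) := fun x hx =>
    (hb.hasDeriv x hx).continuousAt.continuousWithinAt
  have hFcont : ContinuousOn F (Ioi 0) := by
    apply (hbcont.add ((by fun_prop : Continuous fun y : ℝ => y - t).continuousOn.mul hacont)).neg
  have hmono : MonotoneOn (fun y => derivWithin a (Ioi y) y) (Ioi 0) := by
    have := hb.deriv_cvx.monotoneOn_rightDeriv
    rwa [hint] at this
  have hii : ∀ Y, t ≤ Y → IntervalIntegrable (fun y => (y - t) * α y) volume t Y := by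
    intro Y hY
    have h1 : IntervalIntegrable α volume t Y := by
      have : MonotoneOn (fun y => derivWithin a (Ioi y) y) (uIcc t Y) := by
        rw [uIcc_of_le hY]
        exact hmono.mono (fun x hx => lt_of_lt_of_le ht hx.1)
      exact (this.intervalIntegrable (μ := volume)).neg
    exact h1.continuousOn_mul (by fun_prop)
  have hval : ∀ Y, t ≤ Y → ∫ y in t..Y, (y - t) * α y = b t - (b Y + (Y - t) * a Y) := by
    intro Y hY
    rw [intervalIntegral.integral_eq_sub_of_hasDeriv_right_of_le hY
      (hFcont.mono fun x hx => lt_of_lt_of_le ht hx.1)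
      (fun x hx => hder x (lt_trans ht hx.1)) (hii Y hY)]
    simp only [hF, sub_self, zero_mul]; ring
  have hYa : Tendsto (fun Y => (Y - t) * a Y) atTop (nhds 0) := by
    have hup : Tendsto (fun Y : ℝ => 2 * b ((Y + t) / 2)) atTop (nhds 0) := by
      have h1 : Tendsto (fun Y : ℝ => (Y + t) / 2) atTop atTop :=
        (tendsto_atTop_add_const_right _ t tendsto_id).atTop_div_const (by norm_num)
      simpa using (hb.tendsto_zero.comp h1).const_mul 2
    refine tendsto_of_tendsto_of_tendsto_of_le_of_le' tendsto_const_nhds hup ?_ ?_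
    · filter_upwards [eventually_gt_atTop t] with Y hY
      have := hb.deriv_nonpos Y (lt_trans ht hY)
      exact mul_nonneg (by linarith) (by simp only [ha]; linarith)
    · filter_upwards [eventually_gt_atTop t] with Y hY
      have h0 : (0 : ℝ) < (Y + t) / 2 := by linarith
      have hY0 : (0 : ℝ) < Y := lt_trans ht hY
      have h1 := hb.cvx.slope_le_of_hasDerivAt (x := (Y + t) / 2) (y := Y) h0 hY0
        (by linarith) (hb.hasDeriv Y hY0)
      rw [slope_def_field, div_le_iff₀ (by linarith)] at h1
      have := hb.nonneg Y hY0
      simp only [ha]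
      nlinarith
  have hlim : Tendsto (fun Y => ∫ y in t..Y, (y - t) * α y) atTop (nhds (b t)) := by
    have h1 : Tendsto (fun Y => b t - (b Y + (Y - t) * a Y)) atTop (nhds (b t - (0 + 0))) :=
      tendsto_const_nhds.sub (hb.tendsto_zero.add hYa)
    rw [add_zero, sub_zero] at h1
    refine h1.congr' ?_
    filter_upwards [eventually_ge_atTop t] with Y hY
    exact (hval Y hY).symm
  have hint' : IntegrableOn (fun y => (y - t) * α y) (Ioi t) := by
    have hii' : ∀ Y, IntegrableOn (fun y => (y - t) * α y) (Ioc t Y) := by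
      intro Y
      rcases le_total t Y with h | h
      · exact (intervalIntegrable_iff_integrableOn_Ioc_of_le h).1 (hii Y h)
      · simp [Ioc_eq_empty (not_lt.2 h)]
    refine integrableOn_Ioi_of_intervalIntegral_norm_tendsto (b t) t hii' tendsto_id ?_
    refine hlim.congr' ?_
    filter_upwards [eventually_ge_atTop t] with Y hY
    refine intervalIntegral.integral_congr (fun y hy => ?_)
    rw [uIcc_of_le hY] at hy
    have : 0 ≤ (y - t) * α y :=
      mul_nonneg (by linarith [hy.1]) (hαnn y (lt_of_lt_of_le ht hy.1))
    simp only [Real.norm_eq_abs, abs_of_nonneg this]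
  have hcongr : EqOn (fun y => (y - t) * (Ioi (0 : ℝ)).indicator α y)
      (fun y => (y - t) * α y) (Ioi t) := by
    intro y hy
    have : y ∈ Ioi (0 : ℝ) := lt_trans ht hy
    simp only [indicator_of_mem this]
  refine ⟨hint'.congr_fun hcongr.symm measurableSet_Ioi, ?_⟩
  rw [setIntegral_congr_fun measurableSet_Ioi hcongr]
  exact tendsto_nhds_unique hlim (intervalIntegral_tendsto_integral_Ioi t hint' tendsto_id)

/-- `α` is a nonnegative density representing `b` as `b t = ∫ (y - t)₊ α y dy`. -/
structure IsTentDensity (b α : ℝ → ℝ) : Prop where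
  meas : Measurable α
  nonneg : ∀ y, 0 ≤ α y
  integrable : ∀ t > 0, IntegrableOn (fun y => (y - t) * α y) (Ioi t)
  eq_integral : ∀ t > 0, b t = ∫ y in Ioi t, (y - t) * α y

section TentDensity

variable {b α : ℝ → ℝ} {E : Type*} [NormedAddCommGroup E] [NormedSpace ℝ E] {φ : ℝ → E}

theorem IsTentDensity.integrable_prod (h : IsTentDensity b α)
    (hφ : AEStronglyMeasurable φ (volume.restrict (Ioi 0)))
    (hint : IntegrableOn (fun t => b t • φ t) (Ioi 0)) :
    Integrable (Function.uncurry fun t y : ℝ => (Ioi t).indicator (fun y => ((y - t) * α y) • φ t) y)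
      ((volume.restrict (Ioi 0)).prod (volume.restrict (Ioi 0))) := by
  have hbn : ∀ t > 0, 0 ≤ b t := fun t ht => by
    rw [h.eq_integral t ht]
    exact setIntegral_nonneg measurableSet_Ioi fun y hy =>
      mul_nonneg (sub_nonneg.2 (le_of_lt hy)) (h.nonneg y)
  have hIoi : ∀ t ∈ Ioi (0 : ℝ), Ioi t ∩ Ioi 0 = Ioi t := fun t ht =>
    inter_eq_left.2 (Ioi_subset_Ioi (le_of_lt ht))
  have hsm : AEStronglyMeasurable
      (Function.uncurry fun t y : ℝ => (Ioi t).indicator (fun y => ((y - t) * α y) • φ t) y)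
      ((volume.restrict (Ioi 0)).prod (volume.restrict (Ioi 0))) := by
    have h1 : AEStronglyMeasurable (fun p : ℝ × ℝ => ((p.2 - p.1) * α p.2) • φ p.1)
        ((volume.restrict (Ioi 0)).prod (volume.restrict (Ioi 0))) := by
      apply AEStronglyMeasurable.smul
      · exact ((measurable_snd.sub measurable_fst).mul
          (h.meas.comp measurable_snd)).aestronglyMeasurable
      · exact hφ.comp_fst
    exact h1.indicator (s := {p : ℝ × ℝ | p.1 < p.2}) (measurableSet_lt measurable_fst measurable_snd)
  rw [integrable_prod_iff hsm]
  constructor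
  · filter_upwards [ae_restrict_mem measurableSet_Ioi] with t ht
    simp only [Function.uncurry_apply_pair]
    rw [integrable_indicator_iff measurableSet_Ioi, IntegrableOn,
      Measure.restrict_restrict measurableSet_Ioi, hIoi t ht]
    exact (h.integrable t ht).smul_const _
  · refine hint.norm.congr ?_
    filter_upwards [ae_restrict_mem measurableSet_Ioi] with t ht
    simp only [Function.uncurry_apply_pair, norm_indicator_eq_indicator_norm]
    rw [integral_indicator measurableSet_Ioi, Measure.restrict_restrict measurableSet_Ioi,
      hIoi t ht, norm_smul, Real.norm_eq_abs, abs_of_nonneg (hbn t ht), h.eq_integral t ht,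
      ← integral_mul_const]
    refine setIntegral_congr_fun measurableSet_Ioi fun y hy => ?_
    have : 0 ≤ (y - t) * α y := mul_nonneg (sub_nonneg.2 (le_of_lt hy)) (h.nonneg y)
    simp only [norm_smul, Real.norm_eq_abs, abs_of_nonneg this]

theorem IsTentDensity.integral_section (y : ℝ) (hy : 0 < y) :
    ∫ t in Ioi 0, (Ioi t).indicator (fun y => ((y - t) * α y) • φ t) y =
      α y • ∫ t in (0 : ℝ)..y, (y - t) • φ t := by
  have h1 : ∀ t, (Ioi t).indicator (fun y => ((y - t) * α y) • φ t) y =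
      (Iio y).indicator (fun t => α y • ((y - t) • φ t)) t := by
    intro t
    by_cases hty : t < y
    · rw [indicator_of_mem (show y ∈ Ioi t from hty), indicator_of_mem (show t ∈ Iio y from hty),
        smul_smul, mul_comm]
    · rw [indicator_of_notMem (show y ∉ Ioi t from hty),
        indicator_of_notMem (show t ∉ Iio y from hty)]
  simp_rw [h1]
  rw [integral_indicator measurableSet_Iio, Measure.restrict_restrict measurableSet_Iio,
    show Iio y ∩ Ioi 0 = Ioo 0 y from by rw [inter_comm, Ioi_inter_Iio], integral_smul,
    intervalIntegral.integral_of_le hy.le, integral_Ioc_eq_integral_Ioo]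

theorem IsTentDensity.integrableOn_smul (h : IsTentDensity b α)
    (hφ : AEStronglyMeasurable φ (volume.restrict (Ioi 0)))
    (hint : IntegrableOn (fun t => b t • φ t) (Ioi 0)) :
    IntegrableOn (fun y => α y • ∫ t in (0 : ℝ)..y, (y - t) • φ t) (Ioi 0) := by
  refine (h.integrable_prod hφ hint).integral_prod_right.congr ?_
  filter_upwards [ae_restrict_mem measurableSet_Ioi] with y hy
  exact IsTentDensity.integral_section y hy

theorem IsTentDensity.integral_smul [CompleteSpace E] (h : IsTentDensity b α)
    (hφ : AEStronglyMeasurable φ (volume.restrict (Ioi 0)))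
    (hint : IntegrableOn (fun t => b t • φ t) (Ioi 0)) :
    ∫ t in Ioi 0, b t • φ t = ∫ y in Ioi 0, α y • ∫ t in (0 : ℝ)..y, (y - t) • φ t := by
  have h1 := integral_integral_swap (h.integrable_prod hφ hint)
  rw [setIntegral_congr_fun measurableSet_Ioi
    (fun y hy => IsTentDensity.integral_section (α := α) (φ := φ) y hy)] at h1
  rw [← h1]
  refine setIntegral_congr_fun measurableSet_Ioi fun t ht => ?_
  rw [integral_indicator measurableSet_Ioi, Measure.restrict_restrict measurableSet_Ioi,
    inter_eq_left.2 (Ioi_subset_Ioi (le_of_lt ht)), integral_smul_const, ← h.eq_integral t ht]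

end TentDensity

theorem Assumption1.exists_isTentDensity {b b' : ℝ → ℝ} {ρ : ℝ} (hb : Assumption1 b b' ρ) :
    ∃ α, IsTentDensity b α := by
  obtain ⟨α, h1, h2, h3⟩ := hb.exists_density
  exact ⟨α, h1, h2, fun t ht => (h3 t ht).1, fun t ht => (h3 t ht).2⟩

/-- The Laplace transform of the tent function `t ↦ (y - t)₊`. -/
def tentLaplace (z : ℂ) (y : ℝ) : ℂ := (z * y - 1 + Complex.exp (-z * y)) / z ^ 2

theorem tent_re_nonneg {x : ℝ} (η : ℝ) {y : ℝ} (hx : 0 ≤ x) (hy : 0 ≤ y) :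
    0 ≤ (x * y - 1 + Real.exp (-x * y) * Real.cos (η * y)) * (x ^ 2 - η ^ 2) +
      2 * x * η * (η * y - Real.exp (-x * y) * Real.sin (η * y)) := by
  set G : ℝ → ℝ := fun y => (x * y - 1 + Real.exp (-x * y) * Real.cos (η * y)) * (x ^ 2 - η ^ 2) +
      2 * x * η * (η * y - Real.exp (-x * y) * Real.sin (η * y)) -
      (x ^ 2 + η ^ 2) / 2 * ((1 - Real.exp (-x * y) * Real.cos (η * y)) ^ 2 +
        (Real.exp (-x * y) * Real.sin (η * y)) ^ 2) with hG
  have hder : ∀ y, HasDerivAt G (x * (x ^ 2 + η ^ 2) *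
      ((1 - Real.exp (-x * y) * Real.cos (η * y)) ^ 2 +
        (Real.exp (-x * y) * Real.sin (η * y)) ^ 2)) y := by
    intro y
    have hl : ∀ c : ℝ, HasDerivAt (fun y => c * y) c y := fun c => by
      simpa using (hasDerivAt_id y).const_mul c
    have hE := (hl (-x)).exp
    have hc := hE.mul ((hl η).cos)
    have hs := hE.mul ((hl η).sin)
    have := (((((hl x).sub_const 1).add hc).mul_const (x ^ 2 - η ^ 2)).add
      (((hl η).sub hs).const_mul (2 * x * η))).sub
      ((((hc.const_sub 1).pow 2).add (hs.pow 2)).const_mul ((x ^ 2 + η ^ 2) / 2))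
    refine this.congr_deriv ?_
    simp only [Pi.mul_apply, Nat.cast_ofNat]
    ring
  have hmono : Monotone G := monotone_of_hasDerivAt_nonneg hder fun y => by positivity
  have h0 : G 0 = 0 := by simp [hG]
  have h1 := hmono hy
  rw [h0] at h1
  have h2 : 0 ≤ (x ^ 2 + η ^ 2) / 2 * ((1 - Real.exp (-x * y) * Real.cos (η * y)) ^ 2 +
        (Real.exp (-x * y) * Real.sin (η * y)) ^ 2) := by positivity
  simp only [hG] at h1
  linarith

theorem tent_im_nonpos {x η y : ℝ} (hx : 0 ≤ x) (hη : 0 ≤ η) (hy : 0 ≤ y) :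
    (η * y - Real.exp (-x * y) * Real.sin (η * y)) * (x ^ 2 - η ^ 2) -
      2 * x * η * (x * y - 1 + Real.exp (-x * y) * Real.cos (η * y)) ≤ 0 := by
  set G : ℝ → ℝ := fun y =>
    (η * y - Real.exp (-x * y) * Real.sin (η * y)) * (x ^ 2 - η ^ 2) -
      2 * x * η * (x * y - 1 + Real.exp (-x * y) * Real.cos (η * y)) with hG
  have hder : ∀ y, HasDerivAt G (-((x ^ 2 + η ^ 2) * (η * (1 - Real.exp (-x * y) * Real.cos (η * y))
      - x * (Real.exp (-x * y) * Real.sin (η * y))))) y := by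
    intro y
    have hl : ∀ c : ℝ, HasDerivAt (fun y => c * y) c y := fun c => by
      simpa using (hasDerivAt_id y).const_mul c
    have hE := (hl (-x)).exp
    have hc := hE.mul ((hl η).cos)
    have hs := hE.mul ((hl η).sin)
    have := (((hl η).sub hs).mul_const (x ^ 2 - η ^ 2)).sub
      ((((hl x).sub_const 1).add hc).const_mul (2 * x * η))
    refine this.congr_deriv ?_
    ring
  have hanti : AntitoneOn G (Ici 0) := by
    refine antitoneOn_of_hasDerivWithinAt_nonpos (convex_Ici 0)
      (fun y _ => (hder y).continuousAt.continuousWithinAt)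
      (fun y _ => (hder y).hasDerivWithinAt) fun y hy => ?_
    rw [interior_Ici] at hy
    have hy : 0 < y := hy
    have hE : 0 < Real.exp (-x * y) := Real.exp_pos _
    have hs : Real.sin (η * y) ≤ η * y := Real.sin_le (by positivity)
    have hc : Real.cos (η * y) ≤ 1 := Real.cos_le_one _
    have hE1 : Real.exp (-x * y) * (x * y + 1) ≤ 1 := by
      calc Real.exp (-x * y) * (x * y + 1) ≤ Real.exp (-x * y) * Real.exp (x * y) :=
            mul_le_mul_of_nonneg_left (Real.add_one_le_exp _) hE.le
        _ = 1 := by rw [← Real.exp_add]; simp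
    have h1 : x * (Real.exp (-x * y) * Real.sin (η * y)) ≤ x * (Real.exp (-x * y) * (η * y)) := by
      gcongr
    have h2 : η * (Real.exp (-x * y) * Real.cos (η * y)) ≤ η * (Real.exp (-x * y) * 1) := by
      gcongr
    have h3 : η * (Real.exp (-x * y) * (x * y + 1)) ≤ η * 1 := by gcongr
    have : 0 ≤ η * (1 - Real.exp (-x * y) * Real.cos (η * y))
      - x * (Real.exp (-x * y) * Real.sin (η * y)) := by nlinarith
    have := mul_nonneg (by positivity : 0 ≤ x ^ 2 + η ^ 2) this
    linarith
  have h0 : G 0 = 0 := by simp [hG]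
  have h1 := hanti (self_mem_Ici) hy hy
  rw [h0] at h1
  exact h1

theorem tentLaplace_eq (z : ℂ) (y : ℝ) :
    tentLaplace z y = ((((z.re * y - 1 + Real.exp (-z.re * y) * Real.cos (z.im * y)) *
        (z.re ^ 2 - z.im ^ 2) +
      2 * z.re * z.im * (z.im * y - Real.exp (-z.re * y) * Real.sin (z.im * y)) : ℝ) : ℂ) +
      (((z.im * y - Real.exp (-z.re * y) * Real.sin (z.im * y)) * (z.re ^ 2 - z.im ^ 2) -
      2 * z.re * z.im * (z.re * y - 1 + Real.exp (-z.re * y) * Real.cos (z.im * y)) : ℝ) : ℂ)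
        * Complex.I) / ((Complex.normSq z ^ 2 : ℝ) : ℂ) := by
  rcases eq_or_ne z 0 with rfl | hz
  · simp [tentLaplace]
  have hN : ((Complex.normSq z : ℝ) : ℂ) ≠ 0 := by
    exact_mod_cast (Complex.normSq_pos.2 hz).ne'
  have hexp : Complex.exp (-z * y) = (Real.exp (-z.re * y) * Real.cos (z.im * y) : ℝ) +
      (-(Real.exp (-z.re * y) * Real.sin (z.im * y)) : ℝ) * Complex.I := by
    apply Complex.ext <;>
      simp only [Complex.exp_re, Complex.exp_im, Complex.add_re, Complex.add_im, Complex.ofReal_re,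
        Complex.ofReal_im, Complex.mul_re, Complex.mul_im, Complex.neg_re, Complex.neg_im,
        Complex.I_re, Complex.I_im, mul_zero, mul_one, sub_zero, add_zero, zero_add, neg_mul,
        Real.cos_neg, Real.sin_neg, mul_neg]
  have hconj : (Complex.normSq z : ℂ) = z * (starRingEnd ℂ) z := (Complex.mul_conj z).symm
  have hz' : (starRingEnd ℂ) z ≠ 0 := by simpa using hz
  rw [tentLaplace, hexp]
  push_cast
  rw [hconj, div_eq_div_iff (pow_ne_zero 2 hz) (by positivity)]
  have e1 : z = (z.re : ℂ) + z.im * Complex.I := (Complex.re_add_im z).symm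
  have e2 : (starRingEnd ℂ) z = (z.re : ℂ) - z.im * Complex.I := by
    apply Complex.ext <;> simp
  generalize (Complex.exp _) = E
  generalize (Complex.cos _) = c
  generalize (Complex.sin _) = s
  rw [e2]
  set x : ℂ := (z.re : ℂ)
  set η : ℂ := (z.im : ℂ)
  rw [e1]
  have hI : Complex.I ^ 2 = -1 := Complex.I_sq
  have hI3 : Complex.I ^ 3 = -Complex.I := by rw [pow_succ, hI]; ring
  have hI4 : Complex.I ^ 4 = 1 := Complex.I_pow_four
  have hI5 : Complex.I ^ 5 = Complex.I := by rw [pow_succ, hI4]; ring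
  ring_nf
  simp only [hI, hI3, hI4, hI5]
  ring

theorem tentLaplace_re_nonneg {z : ℂ} (hz : 0 ≤ z.re) {y : ℝ} (hy : 0 ≤ y) :
    0 ≤ (tentLaplace z y).re := by
  rw [tentLaplace_eq, Complex.div_ofReal_re]
  refine div_nonneg ?_ (by positivity)
  simpa only [Complex.add_re, Complex.ofReal_re, Complex.mul_re, Complex.ofReal_im, Complex.I_re,
    Complex.I_im, mul_zero, zero_mul, sub_zero, add_zero] using tent_re_nonneg z.im hz hy

theorem tentLaplace_im_nonpos {z : ℂ} (hz : 0 ≤ z.re) (hz' : 0 ≤ z.im) {y : ℝ} (hy : 0 ≤ y) :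
    (tentLaplace z y).im ≤ 0 := by
  rw [tentLaplace_eq, Complex.div_ofReal_im]
  refine div_nonpos_of_nonpos_of_nonneg ?_ (by positivity)
  simpa only [Complex.add_im, Complex.ofReal_re, Complex.mul_im, Complex.ofReal_im, Complex.I_re,
    Complex.I_im, mul_zero, mul_one, zero_add, add_zero] using tent_im_nonpos hz hz' hy

theorem tentLaplace_conj (z : ℂ) (y : ℝ) :
    tentLaplace ((starRingEnd ℂ) z) y = (starRingEnd ℂ) (tentLaplace z y) := by
  simp [tentLaplace, ← Complex.exp_conj]

theorem tentLaplace_im_nonneg {z : ℂ} (hz : 0 ≤ z.re) (hz' : z.im ≤ 0) {y : ℝ} (hy : 0 ≤ y) :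
    0 ≤ (tentLaplace z y).im := by
  have := tentLaplace_im_nonpos (z := (starRingEnd ℂ) z) (by simpa using hz) (by simpa using hz') hy
  rw [tentLaplace_conj, Complex.conj_im] at this
  linarith

theorem sub_one_add_exp_neg_ne_zero {w : ℂ} (hw : 0 ≤ w.re) (hw0 : w ≠ 0) :
    w - 1 + Complex.exp (-w) ≠ 0 := by
  intro h
  have him : w.im - Real.exp (-w.re) * Real.sin w.im = 0 := by
    have := congrArg Complex.im h
    simp [Complex.exp_im] at this
    linarith
  have hE : Real.exp (-w.re) ≤ 1 := Real.exp_le_one_iff.2 (by linarith)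
  have hη : w.im = 0 := by
    by_contra hne
    have h1 := Real.abs_sin_lt_abs hne
    have h2 : |w.im| = Real.exp (-w.re) * |Real.sin w.im| := by
      rw [sub_eq_zero.1 him, abs_mul, abs_of_pos (Real.exp_pos _), ← sub_eq_zero.1 him]
    nlinarith [abs_nonneg (Real.sin w.im), Real.exp_pos (-w.re)]
  have hre : w.re - 1 + Real.exp (-w.re) = 0 := by
    have := congrArg Complex.re h
    simpa [Complex.exp_re, hη] using this
  have hx : w.re ≠ 0 := fun hx => hw0 (Complex.ext hx hη)
  have := Real.add_one_lt_exp (neg_ne_zero.2 hx)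
  linarith

theorem exists_bound_sub_one_add_exp_neg :
    ∃ C > 0, ∀ w : ℂ, 0 ≤ w.re →
      ‖w * (1 - Complex.exp (-w))‖ ≤ C * ‖w - 1 + Complex.exp (-w)‖ := by
  obtain ⟨m, hm, hmb⟩ : ∃ m > 0, ∀ w ∈ (Metric.closedBall (0 : ℂ) 4 \ Metric.ball 0 1) ∩
      {w : ℂ | 0 ≤ w.re}, m ≤ ‖w - 1 + Complex.exp (-w)‖ := by
    have hK : IsCompact ((Metric.closedBall (0 : ℂ) 4 \ Metric.ball 0 1) ∩ {w : ℂ | 0 ≤ w.re}) :=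
      ((isCompact_closedBall 0 4).diff Metric.isOpen_ball).inter_right
        (isClosed_le continuous_const Complex.continuous_re)
    have hne : ((Metric.closedBall (0 : ℂ) 4 \ Metric.ball 0 1) ∩ {w : ℂ | 0 ≤ w.re}).Nonempty :=
      ⟨1, by simp⟩
    obtain ⟨w₀, hw₀, hmin⟩ := hK.exists_isMinOn hne
      (f := fun w : ℂ => ‖w - 1 + Complex.exp (-w)‖) (by fun_prop)
    refine ⟨_, norm_pos_iff.2 (sub_one_add_exp_neg_ne_zero hw₀.2 ?_), fun w hw => hmin hw⟩
    rintro rfl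
    simp at hw₀
  have hexp : ∀ w : ℂ, 0 ≤ w.re → ‖Complex.exp (-w)‖ ≤ 1 := fun w hw => by
    rw [Complex.norm_exp]; simpa using hw
  have h2 : ∀ w : ℂ, 0 ≤ w.re → ‖1 - Complex.exp (-w)‖ ≤ 2 := fun w hw =>
    (norm_sub_le _ _).trans (by rw [norm_one]; linarith [hexp w hw])
  refine ⟨8 + 8 / m, by positivity, fun w hw => ?_⟩
  have hn : 0 ≤ ‖w - 1 + Complex.exp (-w)‖ := norm_nonneg _
  have hm8 : 0 ≤ 8 / m := by positivity
  rw [norm_mul]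
  rcases le_total ‖w‖ 1 with h1 | h1
  · have hb := Complex.exp_bound (x := -w) (by simpa using h1) (n := 3) (by norm_num)
    have hb2 := Complex.exp_bound (x := -w) (by simpa using h1) (n := 1) (by norm_num)
    simp [Finset.sum_range_succ, Nat.factorial] at hb hb2
    have e1 : ‖w ^ 2 / 2‖ = ‖w‖ ^ 2 / 2 := by simp
    have h3 : ‖w ^ 2 / 2‖ ≤ ‖w - 1 + Complex.exp (-w)‖ +
        ‖Complex.exp (-w) - (1 + -w + w ^ 2 / 2)‖ := by
      have := norm_sub_le (w - 1 + Complex.exp (-w)) (Complex.exp (-w) - (1 + -w + w ^ 2 / 2))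
      rwa [show (w - 1 + Complex.exp (-w)) - (Complex.exp (-w) - (1 + -w + w ^ 2 / 2)) =
        w ^ 2 / 2 by ring] at this
    rw [e1] at h3
    rw [norm_sub_rev] at hb2
    have h4 : ‖w‖ ^ 3 ≤ ‖w‖ ^ 2 := pow_le_pow_of_le_one (norm_nonneg _) h1 (by norm_num)
    nlinarith [norm_nonneg w, mul_nonneg hm8 hn]
  rcases le_total ‖w‖ 4 with h4 | h4
  · have := hmb w ⟨⟨by simpa using h4, by simpa using h1⟩, hw⟩
    have h5 : ‖w‖ * ‖1 - Complex.exp (-w)‖ ≤ 8 := by nlinarith [h2 w hw, norm_nonneg w]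
    have h6 : 8 ≤ 8 / m * ‖w - 1 + Complex.exp (-w)‖ := by
      calc (8 : ℝ) = 8 / m * m := by field_simp
        _ ≤ _ := by gcongr
    nlinarith
  · have h3 : ‖w‖ ≤ ‖w - 1 + Complex.exp (-w)‖ + 2 := by
      have := norm_add_le (w - 1 + Complex.exp (-w)) (1 - Complex.exp (-w))
      rw [show w - 1 + Complex.exp (-w) + (1 - Complex.exp (-w)) = w by ring] at this
      linarith [h2 w hw]
    nlinarith [h2 w hw, norm_nonneg w, mul_nonneg hm8 hn]

theorem integral_tent_smul_exp {z : ℂ} (hz : z ≠ 0) (y : ℝ) :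
    ∫ t in (0 : ℝ)..y, (y - t) • Complex.exp (-z * t) = tentLaplace z y := by
  have hder : ∀ t : ℝ, HasDerivAt
      (fun t : ℝ => Complex.exp (-z * t) * (1 / z ^ 2 - ((y : ℂ) - t) / z))
      ((y - t) • Complex.exp (-z * t)) t := by
    intro t
    have h0 : HasDerivAt (fun t : ℝ => (t : ℂ)) 1 t := Complex.ofRealCLM.hasDerivAt
    have h1 := ((h0.const_mul (-z)).cexp).mul
      (((h0.const_sub (y : ℂ)).div_const z).const_sub (1 / z ^ 2))
    refine h1.congr_deriv ?_
    rw [Complex.real_smul]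
    push_cast
    field_simp
    ring
  rw [intervalIntegral.integral_eq_sub_of_hasDerivAt (fun t _ => hder t)
    (by apply Continuous.intervalIntegrable; fun_prop)]
  simp only [tentLaplace, Complex.ofReal_zero, mul_zero, Complex.exp_zero]
  field_simp
  ring

theorem mul_integral_tent_smul_mul_exp {z : ℂ} (hz : z ≠ 0) (y : ℝ) :
    z * ∫ t in (0 : ℝ)..y, (y - t) • ((t : ℂ) * Complex.exp (-z * t)) =
      2 * tentLaplace z y - z * y * (1 - Complex.exp (-(z * y))) / z ^ 2 := by
  have hder : ∀ t : ℝ, HasDerivAt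
      (fun t : ℝ => -(Complex.exp (-z * t) * (t * ((y : ℂ) - t) / z + ((y : ℂ) - 2 * t) / z ^ 2
        - 2 / z ^ 3)))
      ((y - t) • ((t : ℂ) * Complex.exp (-z * t))) t := by
    intro t
    have h0 : HasDerivAt (fun t : ℝ => (t : ℂ)) 1 t := Complex.ofRealCLM.hasDerivAt
    have h1 := (((h0.const_mul (-z)).cexp).mul
      ((((h0.mul (h0.const_sub (y : ℂ))).div_const z).add
        (((h0.const_mul 2).const_sub (y : ℂ)).div_const (z ^ 2))).sub_const (2 / z ^ 3))).neg
    refine h1.congr_deriv ?_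
    rw [Complex.real_smul]
    simp only [Pi.mul_apply, Pi.add_apply]
    push_cast
    field_simp
    ring
  rw [intervalIntegral.integral_eq_sub_of_hasDerivAt (fun t _ => hder t)
    (by apply Continuous.intervalIntegrable; fun_prop)]
  simp only [tentLaplace, Complex.ofReal_zero, mul_zero, Complex.exp_zero, neg_mul]
  field_simp
  ring

theorem Assumption1.integrableOn_smul {b b' : ℝ → ℝ} {ρ : ℝ} (hb : Assumption1 b b' ρ)
    {E : Type*} [NormedAddCommGroup E] [NormedSpace ℝ E] {φ : ℝ → E}
    (hφ : AEStronglyMeasurable φ (volume.restrict (Ioi 0))) {M c : ℝ} (hc : 0 < c)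
    (hbd : ∀ t > 0, ‖φ t‖ ≤ M * Real.exp (-c * t)) :
    IntegrableOn (fun t => b t • φ t) (Ioi 0) := by
  have hbcont : ContinuousOn b (Ioi 0) := fun x hx =>
    (hb.hasDeriv x hx).continuousAt.continuousWithinAt
  have h1 : Integrable (fun t => M * ((Ioc (0 : ℝ) 1).indicator b t + b 1 * Real.exp (-c * t)))
      (volume.restrict (Ioi 0)) := by
    refine Integrable.const_mul (Integrable.add ?_ ?_) M
    · exact ((integrable_indicator_iff measurableSet_Ioc).2 (hb.locInt 1 one_pos)).restrict
    · exact (exp_neg_integrableOn_Ioi 0 hc).const_mul _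
  refine h1.mono' ((hbcont.aestronglyMeasurable measurableSet_Ioi).smul hφ) ?_
  filter_upwards [ae_restrict_mem measurableSet_Ioi] with t ht
  have ht : 0 < t := ht
  have hM : 0 ≤ M := by
    have := (norm_nonneg _).trans (hbd t ht)
    exact nonneg_of_mul_nonneg_left this (Real.exp_pos _)
  have hE : Real.exp (-c * t) ≤ 1 := Real.exp_le_one_iff.2 (by nlinarith)
  have hE0 := Real.exp_pos (-c * t)
  have hb1 := hb.nonneg 1 one_pos
  have hbt := hb.nonneg t ht
  rw [norm_smul, Real.norm_eq_abs, abs_of_nonneg hbt]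
  have h2 : b t * ‖φ t‖ ≤ M * (b t * Real.exp (-c * t)) := by
    have := mul_le_mul_of_nonneg_left (hbd t ht) hbt
    linarith
  refine h2.trans (mul_le_mul_of_nonneg_left ?_ hM)
  by_cases h : t ≤ 1
  · rw [indicator_of_mem (show t ∈ Ioc (0 : ℝ) 1 from ⟨ht, h⟩)]
    nlinarith [mul_nonneg hb1 hE0.le]
  · rw [indicator_of_notMem (fun h' => h h'.2), zero_add]
    exact mul_le_mul_of_nonneg_right (hb.anti (show (0 : ℝ) < 1 from one_pos) ht (le_of_not_ge h)) hE0.le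

theorem norm_exp_neg_mul (z : ℂ) (t : ℝ) : ‖Complex.exp (-z * t)‖ = Real.exp (-z.re * t) := by
  rw [Complex.norm_exp]; simp

theorem norm_mul_exp_neg_mul_le {z : ℂ} (hz : 0 < z.re) {t : ℝ} (ht : 0 ≤ t) :
    ‖(t : ℂ) * Complex.exp (-z * t)‖ ≤ 2 / z.re * Real.exp (-(z.re / 2) * t) := by
  rw [norm_mul, norm_exp_neg_mul, Complex.norm_real, Real.norm_eq_abs, abs_of_nonneg ht]
  have h1 : t ≤ 2 / z.re * Real.exp (z.re / 2 * t) := by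
    have := Real.add_one_le_exp (z.re / 2 * t)
    calc t = 2 / z.re * (z.re / 2 * t) := by field_simp
      _ ≤ _ := by gcongr; linarith
  calc t * Real.exp (-z.re * t)
      ≤ 2 / z.re * Real.exp (z.re / 2 * t) * Real.exp (-z.re * t) := by gcongr
    _ = 2 / z.re * Real.exp (-(z.re / 2) * t) := by
      rw [mul_assoc, ← Real.exp_add]; congr 2; ring

theorem laplaceTransform_eq_integral_smul (b : ℝ → ℝ) (z : ℂ) :
    laplaceTransform b z = ∫ t in Ioi (0 : ℝ), b t • Complex.exp (-z * t) := by
  simp only [laplaceTransform, Complex.real_smul, mul_comm]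

theorem Assumption1.integrableOn_smul_exp {b b' : ℝ → ℝ} {ρ : ℝ} (hb : Assumption1 b b' ρ)
    {z : ℂ} (hz : 0 < z.re) : IntegrableOn (fun t => b t • Complex.exp (-z * t)) (Ioi 0) :=
  hb.integrableOn_smul (by fun_prop) (M := 1) hz fun t _ => by
    rw [norm_exp_neg_mul, one_mul]

theorem Assumption1.integrableOn_smul_mul_exp {b b' : ℝ → ℝ} {ρ : ℝ} (hb : Assumption1 b b' ρ)
    {z : ℂ} (hz : 0 < z.re) :
    IntegrableOn (fun t => b t • ((t : ℂ) * Complex.exp (-z * t))) (Ioi 0) :=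
  hb.integrableOn_smul (by fun_prop) (half_pos hz) fun t ht =>
    norm_mul_exp_neg_mul_le hz (le_of_lt ht)

theorem IsTentDensity.integral_norm_tentLaplace_le {b α : ℝ → ℝ} (h : IsTentDensity b α) {z : ℂ}
    (hz : 0 < z.re) (hint : IntegrableOn (fun t => b t • Complex.exp (-z * t)) (Ioi 0)) :
    IntegrableOn (fun y => α y • tentLaplace z y) (Ioi 0) ∧
      ∫ y in Ioi 0, α y * ‖tentLaplace z y‖ ≤ 2 * ‖laplaceTransform b z‖ := by
  have hz0 : z ≠ 0 := by rintro rfl; simp at hz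
  have hI := h.integrableOn_smul (by fun_prop) hint
  have hL := h.integral_smul (by fun_prop) hint
  simp only [integral_tent_smul_exp hz0] at hI hL
  rw [← laplaceTransform_eq_integral_smul] at hL
  refine ⟨hI, ?_⟩
  have hre : ∫ y in Ioi 0, α y * (tentLaplace z y).re = (laplaceTransform b z).re := by
    rw [hL]
    have := Complex.reCLM.integral_comp_comm hI
    simpa using this
  have him : ∫ y in Ioi 0, α y * (tentLaplace z y).im = (laplaceTransform b z).im := by
    rw [hL]
    have := Complex.imCLM.integral_comp_comm hI
    simpa using this
  have hIre : IntegrableOn (fun y => α y * (tentLaplace z y).re) (Ioi 0) := by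
    have := hI.re
    rw [IntegrableOn]
    simpa using this
  have hIim : IntegrableOn (fun y => α y * (tentLaplace z y).im) (Ioi 0) := by
    have := hI.im
    rw [IntegrableOn]
    simpa using this
  have hIn : IntegrableOn (fun y => α y * ‖tentLaplace z y‖) (Ioi 0) := by
    have := hI.norm
    rw [IntegrableOn]
    simpa [norm_smul, abs_of_nonneg (h.nonneg _)] using this
  have hr := Complex.abs_re_le_norm (laplaceTransform b z)
  have hi := Complex.abs_im_le_norm (laplaceTransform b z)
  obtain ⟨ς, hς1, hς2⟩ : ∃ ς : ℝ, |ς| = 1 ∧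
      ∀ y > 0, ‖tentLaplace z y‖ ≤ (tentLaplace z y).re + ς * (tentLaplace z y).im := by
    have hn : ∀ y > 0, ‖tentLaplace z y‖ ≤ (tentLaplace z y).re + |(tentLaplace z y).im| :=
      fun y hy => by
        have := Complex.norm_le_abs_re_add_abs_im (tentLaplace z y)
        rwa [abs_of_nonneg (tentLaplace_re_nonneg hz.le (le_of_lt hy))] at this
    rcases le_total 0 z.im with h0 | h0
    · refine ⟨-1, by simp, fun y hy => (hn y hy).trans_eq ?_⟩
      rw [abs_of_nonpos (tentLaplace_im_nonpos hz.le h0 (le_of_lt hy))]; ring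
    · refine ⟨1, by simp, fun y hy => (hn y hy).trans_eq ?_⟩
      rw [abs_of_nonneg (tentLaplace_im_nonneg hz.le h0 (le_of_lt hy))]; ring
  calc ∫ y in Ioi 0, α y * ‖tentLaplace z y‖
      ≤ ∫ y in Ioi 0, (α y * (tentLaplace z y).re + ς * (α y * (tentLaplace z y).im)) := by
        refine setIntegral_mono_on hIn (hIre.add (hIim.const_mul ς)) measurableSet_Ioi
          fun y hy => ?_
        have := mul_le_mul_of_nonneg_left (hς2 y hy) (h.nonneg y)
        linarith
    _ = (laplaceTransform b z).re + ς * (laplaceTransform b z).im := by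
        rw [integral_add hIre (hIim.const_mul ς), integral_const_mul, hre, him]
    _ ≤ |(laplaceTransform b z).re| + |ς * (laplaceTransform b z).im| :=
        add_le_add (le_abs_self _) (le_abs_self _)
    _ ≤ 2 * ‖laplaceTransform b z‖ := by rw [abs_mul, hς1]; linarith

/-- First-order regularity of the kernel: `|z b̂'(z)| ≤ C |b̂(z)|` on the right half plane. -/
theorem Assumption1.exists_regularity {b b' : ℝ → ℝ} {ρ : ℝ} (hb : Assumption1 b b' ρ) :
    ∃ C > 0, ∀ z : ℂ, 0 < z.re →
      ‖z * ∫ t in Ioi (0 : ℝ), b t • ((t : ℂ) * Complex.exp (-z * t))‖ ≤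
        C * ‖laplaceTransform b z‖ := by
  obtain ⟨α, h⟩ := hb.exists_isTentDensity
  obtain ⟨C, hC, hCb⟩ := exists_bound_sub_one_add_exp_neg
  refine ⟨(2 + C) * 2, by positivity, fun z hz => ?_⟩
  have hz0 : z ≠ 0 := by rintro rfl; simp at hz
  obtain ⟨hI, hle⟩ := h.integral_norm_tentLaplace_le hz (hb.integrableOn_smul_exp hz)
  rw [h.integral_smul (by fun_prop) (hb.integrableOn_smul_mul_exp hz), ← integral_const_mul]
  have hIn : IntegrableOn (fun y => α y * ‖tentLaplace z y‖) (Ioi 0) := by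
    have := hI.norm
    rw [IntegrableOn]
    simpa [norm_smul, abs_of_nonneg (h.nonneg _)] using this
  calc _ ≤ ∫ y in Ioi 0, (2 + C) * (α y * ‖tentLaplace z y‖) := by
        refine norm_integral_le_of_norm_le (hIn.const_mul _) ?_
        filter_upwards [ae_restrict_mem measurableSet_Ioi] with y hy
        have hy : 0 < y := hy
        rw [mul_smul_comm, mul_integral_tent_smul_mul_exp hz0, norm_smul, Real.norm_eq_abs,
          abs_of_nonneg (h.nonneg y), mul_left_comm (2 + C)]
        refine mul_le_mul_of_nonneg_left ?_ (h.nonneg y)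
        refine (norm_sub_le _ _).trans ?_
        have h1 := hCb (z * y) (by simpa using mul_nonneg hz.le hy.le)
        have h2 : ‖z * y * (1 - Complex.exp (-(z * y))) / z ^ 2‖ ≤ C * ‖tentLaplace z y‖ := by
          rw [tentLaplace, norm_div, norm_div, ← mul_div_assoc, neg_mul]
          gcongr
        rw [norm_mul, Complex.norm_ofNat]
        linarith
    _ = (2 + C) * ∫ y in Ioi 0, α y * ‖tentLaplace z y‖ := integral_const_mul _ _
    _ ≤ (2 + C) * (2 * ‖laplaceTransform b z‖) := by gcongr
    _ = _ := by ring

theorem Assumption1.exists_sector {b b' : ℝ → ℝ} {ρ : ℝ} (hb : Assumption1 b b' ρ) :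
    ∃ κ > 0, ∀ z : ℂ, 0 < z.re → κ * ‖laplaceTransform b z‖ ≤ (laplaceTransform b z).re := by
  have hpi := Real.pi_pos
  set S := {θ : ℝ | ∃ z : ℂ, 0 < z.re ∧ θ = |(laplaceTransform b z).arg|} with hS
  have hbdd : BddAbove S := ⟨Real.pi, by rintro θ ⟨z, -, rfl⟩; exact Complex.abs_arg_le_pi _⟩
  have hsup : sSup S = (ρ - 1) * (Real.pi / 2) := by
    have := hb.rho_eq
    rw [← hS] at this
    rw [this]; field_simp; ring
  have hlt : sSup S < Real.pi / 2 := by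
    rw [hsup]; nlinarith [hb.rho_mem.2]
  have hnn : 0 ≤ sSup S := by
    rw [hsup]; nlinarith [hb.rho_mem.1]
  refine ⟨Real.cos (sSup S), Real.cos_pos_of_mem_Ioo ⟨by linarith, hlt⟩, fun z hz => ?_⟩
  rcases eq_or_ne (laplaceTransform b z) 0 with h0 | h0
  · simp [h0]
  have harg : |(laplaceTransform b z).arg| ≤ sSup S := le_csSup hbdd ⟨z, hz, rfl⟩
  have hcos : Real.cos (sSup S) ≤ Real.cos (laplaceTransform b z).arg := by
    rw [← Real.cos_abs (laplaceTransform b z).arg]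
    exact Real.cos_le_cos_of_nonneg_of_le_pi (abs_nonneg _) (by linarith) harg
  rw [Complex.cos_arg h0, le_div_iff₀ (norm_pos_iff.2 h0)] at hcos
  exact hcos

section PositiveType

variable {θ : ℝ → ℝ}

/-- The tent kernel `(y - r)₊` is of positive type. -/
theorem integral_mul_integral_tent_nonneg (hθ : Continuous θ) {t y : ℝ} (ht : 0 ≤ t) (hy : 0 ≤ y)
    {Θ Ψ : ℝ → ℝ} (hΘc : Continuous Θ) (hΘ0 : ∀ τ ≤ 0, Θ τ = 0)
    (hΘ : ∀ τ > 0, HasDerivAt Θ (θ τ) τ)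
    (hΨ : ∀ τ, HasDerivAt Ψ (Θ τ) τ) :
    0 ≤ ∫ τ in (0 : ℝ)..t, θ τ * (y * Θ τ - (Ψ τ - Ψ (τ - y))) := by
  have hΨc : Continuous Ψ := continuous_iff_continuousAt.2 fun τ => (hΨ τ).continuousAt
  set Q : ℝ → ℝ := fun τ => ∫ u in (0 : ℝ)..τ, Θ u ^ 2 with hQ
  have hQd : ∀ τ, HasDerivAt Q (Θ τ ^ 2) τ := fun τ =>
    intervalIntegral.integral_hasDerivAt_right ((hΘc.pow 2).intervalIntegrable _ _)
      ((hΘc.pow 2).stronglyMeasurableAtFilter _ _) (hΘc.pow 2).continuousAt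
  have hQc : Continuous Q := continuous_iff_continuousAt.2 fun τ => (hQd τ).continuousAt
  have hQ0 : ∀ τ ≤ 0, Q τ = 0 := fun τ hτ => by
    rw [hQ]
    simp only
    rw [intervalIntegral.integral_symm, neg_eq_zero]
    refine (intervalIntegral.integral_congr (g := fun _ => 0) fun u hu => ?_).trans (by simp)
    rw [uIcc_of_le hτ] at hu
    simp [hΘ0 u hu.2]
  set R : ℝ → ℝ := fun τ =>
    (y * Θ τ ^ 2 - 2 * (Θ τ * (Ψ τ - Ψ (τ - y))) + (Q τ - Q (τ - y))) / 2 with hR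
  have hRc : Continuous R := by fun_prop
  have hRd : ∀ τ > 0, HasDerivAt R
      (θ τ * (y * Θ τ - (Ψ τ - Ψ (τ - y))) - (Θ τ - Θ (τ - y)) ^ 2 / 2) τ := fun τ hτ => by
    have h1 := hΘ τ hτ
    have h2 := (hΨ τ).sub ((hΨ (τ - y)).comp_sub_const τ y)
    have h3 := (hQd τ).sub ((hQd (τ - y)).comp_sub_const τ y)
    refine (((((h1.pow 2).const_mul y).sub ((h1.mul h2).const_mul 2)).add h3).div_const
      2).congr_deriv ?_
    simp only [Pi.sub_apply]
    push_cast
    ring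
  have hRt : 0 ≤ R t := by
    have hi : R t = (∫ u in (t - y)..t, (Θ t - Θ u) ^ 2) / 2 := by
      have : ∀ u, (Θ t - Θ u) ^ 2 = Θ t ^ 2 - 2 * Θ t * Θ u + Θ u ^ 2 := fun u => by ring
      simp only [this]
      rw [intervalIntegral.integral_eq_sub_of_hasDerivAt
        (f := fun u => Θ t ^ 2 * u - 2 * Θ t * Ψ u + Q u)]
      · simp only [hR]; ring
      · intro u _
        refine ((((hasDerivAt_id u).const_mul (Θ t ^ 2)).sub ((hΨ u).const_mul (2 * Θ t))).add
          (hQd u)).congr_deriv ?_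
        simp
      · exact Continuous.intervalIntegrable (by fun_prop) _ _
    rw [hi]
    have := intervalIntegral.integral_nonneg (μ := volume) (show t - y ≤ t by linarith)
      fun u _ => sq_nonneg (Θ t - Θ u)
    linarith
  have hint1 : IntervalIntegrable (fun τ => θ τ * (y * Θ τ - (Ψ τ - Ψ (τ - y)))) volume 0 t :=
    Continuous.intervalIntegrable (by fun_prop) _ _
  have hint2 : IntervalIntegrable (fun τ => (Θ τ - Θ (τ - y)) ^ 2 / 2) volume 0 t :=
    Continuous.intervalIntegrable (by fun_prop) _ _
  have key := intervalIntegral.integral_eq_sub_of_hasDerivAt_of_le ht hRc.continuousOn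
    (fun τ hτ => hRd τ hτ.1) (hint1.sub hint2)
  rw [intervalIntegral.integral_sub hint1 hint2] at key
  have h0 : R 0 = 0 := by
    simp [hR, hΘ0 0 le_rfl, hQ0 0 le_rfl, hQ0 (-y) (by linarith)]
  have h2 : 0 ≤ ∫ τ in (0 : ℝ)..t, (Θ τ - Θ (τ - y)) ^ 2 / 2 :=
    intervalIntegral.integral_nonneg ht fun u _ => by positivity
  linarith

theorem Assumption1.positive_type_of_continuous {b b' : ℝ → ℝ} {ρ : ℝ} (hb : Assumption1 b b' ρ)
    (hθ : Continuous θ) {M : ℝ} (hM : ∀ u, |θ u| ≤ M) {t : ℝ} (ht : 0 ≤ t) :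
    0 ≤ ∫ τ in (0 : ℝ)..t, θ τ * ∫ u in (0 : ℝ)..τ, b (τ - u) * θ u := by
  obtain ⟨α, h⟩ := hb.exists_isTentDensity
  have hM0 : 0 ≤ M := (abs_nonneg _).trans (hM 0)
  set ψ : ℝ → ℝ := (Ioi 0).indicator θ with hψ
  have hψm : Measurable ψ := hθ.measurable.indicator measurableSet_Ioi
  have hψM : ∀ u, ‖ψ u‖ ≤ M := fun u =>
    (norm_indicator_le_norm_self _ _).trans (hM u)
  have hψi : ∀ a c, IntervalIntegrable ψ volume a c := fun a c =>
    intervalIntegrable_const.mono_fun' (g := fun _ => M) hψm.aestronglyMeasurable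
      (ae_of_all _ hψM)
  set Θ : ℝ → ℝ := fun τ => ∫ u in (0 : ℝ)..τ, ψ u with hΘdef
  have hΘc : Continuous Θ := intervalIntegral.continuous_primitive hψi 0
  have hzero : ∀ g : ℝ → ℝ, (∀ u ≤ 0, g u = 0) → ∀ τ ≤ 0, ∫ u in (0 : ℝ)..τ, g u = 0 := by
    intro g hg τ hτ
    rw [intervalIntegral.integral_symm, neg_eq_zero]
    refine (intervalIntegral.integral_congr (g := fun _ => 0) fun u hu => ?_).trans (by simp)
    rw [uIcc_of_le hτ] at hu
    exact hg u hu.2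
  have hΘ0 : ∀ τ ≤ 0, Θ τ = 0 := hzero ψ fun u hu => indicator_of_notMem (by simpa using hu) _
  have hΘd : ∀ τ > 0, HasDerivAt Θ (θ τ) τ := fun τ hτ => by
    have hev : ψ =ᶠ[nhds τ] θ := by
      filter_upwards [Ioi_mem_nhds hτ] with u hu
      exact indicator_of_mem hu _
    have := intervalIntegral.integral_hasDerivAt_right (hψi 0 τ)
      hψm.stronglyMeasurable.stronglyMeasurableAtFilter (hθ.continuousAt.congr hev.symm)
    rwa [hev.eq_of_nhds] at this
  have hΘd0 : ∀ τ < 0, HasDerivAt Θ (ψ τ) τ := fun τ hτ => by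
    have hev : Θ =ᶠ[nhds τ] fun _ => 0 := by
      filter_upwards [Iio_mem_nhds hτ] with u hu
      exact hΘ0 u (le_of_lt hu)
    rw [hψ, indicator_of_notMem (by simpa using hτ.le)]
    exact (hasDerivAt_const τ (0 : ℝ)).congr_of_eventuallyEq hev
  set Ψ : ℝ → ℝ := fun τ => ∫ u in (0 : ℝ)..τ, Θ u with hΨdef
  have hΨd : ∀ τ, HasDerivAt Ψ (Θ τ) τ := fun τ =>
    intervalIntegral.integral_hasDerivAt_right (hΘc.intervalIntegrable _ _)
      (hΘc.stronglyMeasurableAtFilter _ _) hΘc.continuousAt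
  have hΨc : Continuous Ψ := continuous_iff_continuousAt.2 fun τ => (hΨd τ).continuousAt
  have htent : ∀ y τ : ℝ, ∫ r in (0 : ℝ)..y, (y - r) • ψ (τ - r) =
      y * Θ τ - (Ψ τ - Ψ (τ - y)) := by
    intro y τ
    have hi : IntervalIntegrable (fun r => (y - r) • ψ (τ - r)) volume 0 y :=
      IntervalIntegrable.continuousOn_smul (by simpa using ((hψi (τ - 0) (τ - y)).comp_sub_left τ))
        (by fun_prop)
    rw [integral_eq_of_hasDerivAt_off_countable
      (fun r => Ψ (τ - r) - (y - r) * Θ (τ - r)) _ (countable_singleton τ)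
      (by fun_prop) ?_ hi]
    · simp; ring
    · rintro r ⟨-, hr⟩
      have hr' : τ - r ≠ 0 := fun h0 => hr (by simp; linarith)
      have hd : HasDerivAt Θ (ψ (τ - r)) (τ - r) := by
        rcases lt_or_gt_of_ne hr' with h0 | h0
        · exact hΘd0 _ h0
        · rw [hψ, indicator_of_mem (show τ - r ∈ Ioi 0 from h0)]; exact hΘd _ h0
      refine (((hΨd (τ - r)).comp_const_sub τ r).sub
        (((hasDerivAt_id r).const_sub y).mul (hd.comp_const_sub τ r))).congr_deriv ?_
      simp
  have hbψ : ∀ τ ≥ 0, IntegrableOn (fun r => b r • ψ (τ - r)) (Ioi 0) := fun τ hτ => by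
    refine hb.integrableOn_smul (hψm.comp (measurable_const.sub measurable_id)).aestronglyMeasurable
      (M := M * Real.exp τ) one_pos fun r hr => ?_
    rcases le_or_gt τ r with h0 | h0
    · rw [hψ, indicator_of_notMem (by simpa using h0), norm_zero]; positivity
    · refine (hψM _).trans ?_
      rw [mul_assoc, ← Real.exp_add]
      exact le_mul_of_one_le_right hM0 (Real.one_le_exp (by linarith))
  have hconv : ∀ τ > 0, ∫ u in (0 : ℝ)..τ, b (τ - u) * θ u =
      ∫ y in Ioi 0, α y * (y * Θ τ - (Ψ τ - Ψ (τ - y))) := by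
    intro τ hτ
    have h1 := h.integral_smul (φ := fun r => ψ (τ - r))
      (hψm.comp (measurable_const.sub measurable_id)).aestronglyMeasurable (hbψ τ hτ.le)
    simp only [htent] at h1
    simp only [smul_eq_mul] at h1
    rw [← h1]
    have h2 := intervalIntegral.integral_comp_sub_left (a := 0) (b := τ)
      (fun r => b r * θ (τ - r)) τ
    simp only [sub_sub_cancel, sub_zero, sub_self] at h2
    rw [h2, intervalIntegral.integral_of_le hτ.le]
    have h3 : ∀ r, r ∈ Ioi (0:ℝ) → r ∉ Ioo (0 : ℝ) τ → b r * ψ (τ - r) = 0 := fun r hr hr' => by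
      rw [hψ, indicator_of_notMem, mul_zero]
      intro hc
      exact hr' ⟨hr, by simpa using hc⟩
    rw [integral_Ioc_eq_integral_Ioo]
    have h4 := setIntegral_eq_of_subset_of_forall_sdiff_eq_zero (μ := volume) measurableSet_Ioi
      (Ioo_subset_Ioi_self : Ioo (0 : ℝ) τ ⊆ Ioi 0) (f := fun r => b r * ψ (τ - r))
      fun r hr => h3 r hr.1 hr.2
    rw [h4]
    refine setIntegral_congr_fun measurableSet_Ioo fun r hr => ?_
    simp only [hψ]
    rw [indicator_of_mem (by simpa using hr.2)]
  have hI : Integrable (Function.uncurry fun τ y => θ τ * (α y * (y * Θ τ - (Ψ τ - Ψ (τ - y)))))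
      ((volume.restrict (Ioc 0 t)).prod (volume.restrict (Ioi 0))) := by
    set χ : ℝ → ℝ := (Iic t).indicator fun _ => 1 with hχ
    have hχm : Measurable χ := measurable_const.indicator measurableSet_Iic
    have hχi : IntegrableOn (fun r => b r • χ r) (Ioi 0) := by
      refine hb.integrableOn_smul hχm.aestronglyMeasurable (M := Real.exp t) one_pos fun r hr => ?_
      rcases le_or_gt r t with h0 | h0
      · rw [hχ, indicator_of_mem (by simpa using h0), norm_one, ← Real.exp_add]
        exact Real.one_le_exp (by linarith)
      · rw [hχ, indicator_of_notMem (by simpa using h0), norm_zero]; positivity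
    have hk := h.integrableOn_smul hχm.aestronglyMeasurable hχi
    have hdom := Integrable.mul_prod (μ := volume.restrict (Ioc 0 t))
      (ν := volume.restrict (Ioi 0)) (f := fun _ : ℝ => M * M) (integrable_const _) hk
    have hmeas : Measurable fun p : ℝ × ℝ =>
        θ p.1 * (α p.2 * (p.2 * Θ p.1 - (Ψ p.1 - Ψ (p.1 - p.2)))) := by
      have := h.meas
      have := hθ.measurable
      have := hΘc.measurable
      have := hΨc.measurable
      fun_prop
    refine hdom.mono' hmeas.aestronglyMeasurable ?_
    rw [Measure.prod_restrict]
    filter_upwards [ae_restrict_mem (measurableSet_Ioc.prod measurableSet_Ioi)] with p hp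
    obtain ⟨⟨hp1, hp2⟩, hp3⟩ := hp
    have hp3 : 0 < p.2 := hp3
    have hbound : |p.2 * Θ p.1 - (Ψ p.1 - Ψ (p.1 - p.2))| ≤
        M * ∫ r in (0 : ℝ)..p.2, (p.2 - r) • χ r := by
      rw [← htent, ← intervalIntegral.integral_const_mul, ← Real.norm_eq_abs]
      refine intervalIntegral.norm_integral_le_of_norm_le hp3.le ?_ ?_
      · refine ae_of_all _ fun r hr => ?_
        rw [norm_smul, Real.norm_eq_abs, abs_of_nonneg (sub_nonneg.2 hr.2), smul_eq_mul,
          mul_left_comm]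
        refine mul_le_mul_of_nonneg_left ?_ (sub_nonneg.2 hr.2)
        rcases le_or_gt r t with h0 | h0
        · rw [hχ, indicator_of_mem (by simpa using h0), mul_one]; exact hψM _
        · rw [hψ, indicator_of_notMem (by simp; linarith), norm_zero]
          exact mul_nonneg hM0 (indicator_nonneg (fun _ _ => zero_le_one) _)
      · refine IntervalIntegrable.const_mul (IntervalIntegrable.continuousOn_smul ?_
          (by fun_prop)) M
        refine intervalIntegrable_const.mono_fun' (g := fun _ => 1) hχm.aestronglyMeasurable
          (ae_of_all _ fun r => ?_)
        exact (norm_indicator_le_norm_self _ _).trans (by simp)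
    simp only [Function.uncurry]
    rw [norm_mul, norm_mul, Real.norm_eq_abs, Real.norm_eq_abs, Real.norm_eq_abs,
      abs_of_nonneg (h.nonneg _), smul_eq_mul]
    have hk0 := (abs_nonneg _).trans hbound
    calc |θ p.1| * (α p.2 * |p.2 * Θ p.1 - (Ψ p.1 - Ψ (p.1 - p.2))|)
        ≤ M * (α p.2 * (M * ∫ r in (0 : ℝ)..p.2, (p.2 - r) • χ r)) := by
          have := h.nonneg p.2
          gcongr
          exact hM _
      _ = _ := by ring
  have hswap := integral_integral_swap hI
  rw [intervalIntegral.integral_of_le ht]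
  have h5 : ∫ τ in Ioc 0 t, θ τ * ∫ u in (0 : ℝ)..τ, b (τ - u) * θ u =
      ∫ τ in Ioc 0 t, ∫ y in Ioi 0, θ τ * (α y * (y * Θ τ - (Ψ τ - Ψ (τ - y)))) := by
    refine setIntegral_congr_fun measurableSet_Ioc fun τ hτ => ?_
    rw [hconv τ hτ.1, integral_const_mul]
  rw [h5, hswap]
  refine setIntegral_nonneg measurableSet_Ioi fun y hy => ?_
  simp only [mul_left_comm (θ _)]
  rw [integral_const_mul, ← intervalIntegral.integral_of_le ht]
  exact mul_nonneg (h.nonneg y) (integral_mul_integral_tent_nonneg hθ ht (le_of_lt hy) hΘc hΘ0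
    hΘd hΨd)

/-- A 3-monotone kernel is of positive type. -/
theorem Assumption1.positive_type {b b' : ℝ → ℝ} {ρ : ℝ} (hb : Assumption1 b b' ρ)
    {t : ℝ} (ht : 0 ≤ t) (hθ : ContinuousOn θ (Icc 0 t)) :
    0 ≤ ∫ τ in (0 : ℝ)..t, θ τ * ∫ u in (0 : ℝ)..τ, b (τ - u) * θ u := by
  set η : ℝ → ℝ := IccExtend ht ((Icc 0 t).domRestrict θ) with hη
  have hηθ : ∀ u ∈ Icc 0 t, η u = θ u := fun u hu => IccExtend_of_mem ht _ hu
  have hηc : Continuous η := (continuousOn_iff_continuous_domRestrict.1 hθ).Icc_extend'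
  obtain ⟨M, hM⟩ := isCompact_Icc.exists_bound_of_continuousOn hθ
  have hηM : ∀ u, |η u| ≤ M := fun u => hM _ (projIcc 0 t ht u).2
  have := hb.positive_type_of_continuous hηc hηM ht
  refine this.trans_eq (intervalIntegral.integral_congr fun τ hτ => ?_)
  rw [uIcc_of_le ht] at hτ
  rw [hηθ τ hτ]
  congr 1
  refine intervalIntegral.integral_congr fun u hu => ?_
  rw [uIcc_of_le hτ.1] at hu
  rw [hηθ u ⟨hu.1, hu.2.trans hτ.2⟩]

end PositiveType

section ScalarSolution

variable {b b' s s' : ℝ → ℝ} {ρ lam : ℝ}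

theorem Assumption1.intervalIntegrable (hb : Assumption1 b b' ρ) {t : ℝ} (ht : 0 ≤ t) :
    IntervalIntegrable b volume 0 t := by
  rcases ht.eq_or_lt with rfl | ht
  · exact IntervalIntegrable.refl
  · exact (intervalIntegrable_iff_integrableOn_Ioc_of_le ht.le).2 (hb.locInt t ht)

theorem Assumption1.intervalIntegrable_conv (hb : Assumption1 b b' ρ) {t : ℝ} (ht : 0 ≤ t)
    (hs : ContinuousOn s (Icc 0 t)) :
    IntervalIntegrable (fun u => b (t - u) * s u) volume 0 t := by
  have h := (hb.intervalIntegrable ht).comp_sub_left t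
  simp only [sub_zero, sub_self] at h
  exact h.symm.mul_continuousOn (by rwa [uIcc_of_le ht])

theorem Assumption1.abs_conv_le (hb : Assumption1 b b' ρ) {t M : ℝ} (ht : 0 ≤ t)
    (hM : ∀ u ∈ Icc 0 t, |s u| ≤ M) :
    |∫ u in (0 : ℝ)..t, b (t - u) * s u| ≤ M * ∫ u in (0 : ℝ)..t, b u := by
  have h := (hb.intervalIntegrable ht).comp_sub_left t
  simp only [sub_zero, sub_self] at h
  have h2 := intervalIntegral.integral_comp_sub_left (a := 0) (b := t) b t
  simp only [sub_zero, sub_self] at h2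
  rw [← h2, ← intervalIntegral.integral_const_mul, ← Real.norm_eq_abs]
  refine intervalIntegral.norm_integral_le_of_norm_le ht ?_ (h.symm.const_mul M)
  have hne : ∀ᵐ u : ℝ ∂volume, u ≠ t := by simp [ae_iff]
  filter_upwards [hne] with u hut hu
  have hb0 := hb.nonneg (t - u) (sub_pos.2 (lt_of_le_of_ne hu.2 hut))
  rw [norm_mul, Real.norm_eq_abs, Real.norm_eq_abs, abs_of_nonneg hb0, mul_comm]
  exact mul_le_mul_of_nonneg_right (hM u ⟨hu.1.le, hu.2⟩) hb0

theorem Assumption1.continuousAt_conv (hb : Assumption1 b b' ρ) (hs : ContinuousOn s (Ici 0))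
    {t : ℝ} (ht : 0 < t) :
    ContinuousAt (fun t => ∫ u in (0 : ℝ)..t, b (t - u) * s u) t := by
  obtain ⟨M, hM⟩ := isCompact_Icc.exists_bound_of_continuousOn
    (hs.mono (Icc_subset_Ici_self : Icc 0 (t + 1) ⊆ Ici 0))
  have hM0 : 0 ≤ M := (norm_nonneg _).trans (hM 0 ⟨le_rfl, by linarith⟩)
  set ψ : ℝ → ℝ := (Ioi 0).indicator s with hψ
  have hψm : Measurable ψ := by
    have := (hs.mono Ioi_subset_Ici_self).measurable_piecewise
      (continuousOn_const (c := (0 : ℝ))) measurableSet_Ioi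
    rw [hψ, ← piecewise_eq_indicator]
    exact this
  have hψM : ∀ u ≤ t + 1, ‖ψ u‖ ≤ M := fun u hu => by
    by_cases h0 : u ∈ Ioi (0 : ℝ)
    · rw [hψ, indicator_of_mem h0]; exact hM u ⟨le_of_lt h0, hu⟩
    · rw [hψ, indicator_of_notMem h0, norm_zero]; exact hM0
  have hev : (fun t => ∫ u in (0 : ℝ)..t, b (t - u) * s u) =ᶠ[nhds t]
      fun τ => ∫ r in Ioc 0 (t + 1), b r * ψ (τ - r) := by
    filter_upwards [Ioo_mem_nhds ht (lt_add_one t)] with τ hτ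
    have h2 := intervalIntegral.integral_comp_sub_left (a := 0) (b := τ)
      (fun r => b r * s (τ - r)) τ
    simp only [sub_sub_cancel, sub_zero, sub_self] at h2
    rw [h2, intervalIntegral.integral_of_le hτ.1.le, integral_Ioc_eq_integral_Ioo]
    rw [setIntegral_eq_of_subset_of_forall_sdiff_eq_zero (μ := volume) measurableSet_Ioc
      (s := Ioo 0 τ) (fun r hr => ⟨hr.1, by linarith [hr.2, hτ.2]⟩)]
    · refine setIntegral_congr_fun measurableSet_Ioo fun r hr => ?_
      simp only [hψ]
      rw [indicator_of_mem (by simpa using hr.2)]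
    · rintro r ⟨hr, hr'⟩
      rw [hψ, indicator_of_notMem, mul_zero]
      intro hc
      exact hr' ⟨hr.1, by simpa using hc⟩
  refine ContinuousAt.congr ?_ hev.symm
  refine continuousAt_of_dominated (bound := fun r => b r * M) ?_ ?_ ?_ ?_
  · refine Eventually.of_forall fun τ => ?_
    exact (hb.locInt (t + 1) (by linarith)).aestronglyMeasurable.mul
      (hψm.comp (measurable_const.sub measurable_id)).aestronglyMeasurable
  · filter_upwards [Iio_mem_nhds (lt_add_one t)] with τ hτ
    filter_upwards [ae_restrict_mem measurableSet_Ioc] with r hr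
    have := hb.nonneg r hr.1
    rw [norm_mul, Real.norm_eq_abs, abs_of_nonneg this]
    exact mul_le_mul_of_nonneg_left (hψM _ (by linarith [hr.1, show τ < t + 1 from hτ])) this
  · exact (hb.locInt (t + 1) (by linarith)).mul_const M
  · have hne : ∀ᵐ u : ℝ ∂volume.restrict (Ioc 0 (t + 1)), u ≠ t :=
      ae_restrict_of_ae (by simp [ae_iff])
    filter_upwards [hne] with r hr
    have hd : ContinuousAt ψ (t - r) := by
      rcases lt_or_gt_of_ne hr with h0 | h0
      · have h1 : t - r ∈ Ioi (0 : ℝ) := sub_pos.2 h0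
        refine (hs.continuousAt (Ici_mem_nhds h1)).congr ?_
        filter_upwards [Ioi_mem_nhds h1] with u hu
        rw [hψ, indicator_of_mem (show u ∈ Ioi 0 from hu)]
      · refine continuousAt_const (y := (0 : ℝ)).congr ?_
        filter_upwards [Iio_mem_nhds (sub_neg.2 h0)] with u hu
        rw [hψ, indicator_of_notMem (by simpa using le_of_lt hu)]
    exact continuousAt_const.mul (ContinuousAt.comp (f := fun τ => τ - r) hd (by fun_prop))

theorem IsScalarSolution.deriv_eq (hs : IsScalarSolution b lam s s') {t : ℝ} (ht : 0 < t) :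
    s' t = -(lam * ∫ u in (0 : ℝ)..t, b (t - u) * s u) :=
  eq_neg_of_add_eq_zero_left (hs.eqn t ht)

theorem IsScalarSolution.continuousAt_deriv (hs : IsScalarSolution b lam s s')
    (hb : Assumption1 b b' ρ) {t : ℝ} (ht : 0 < t) : ContinuousAt s' t := by
  refine (((hb.continuousAt_conv hs.cont ht).const_mul lam).neg).congr ?_
  filter_upwards [Ioi_mem_nhds ht] with τ hτ
  exact (hs.deriv_eq hτ).symm

theorem IsScalarSolution.intervalIntegrable_deriv (hs : IsScalarSolution b lam s s')
    (hb : Assumption1 b b' ρ) (hl : 0 < lam) {t : ℝ} (ht : 0 ≤ t) :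
    IntervalIntegrable s' volume 0 t := by
  obtain ⟨M, hM⟩ := isCompact_Icc.exists_bound_of_continuousOn
    (hs.cont.mono (Icc_subset_Ici_self : Icc 0 t ⊆ Ici 0))
  have hM0 : 0 ≤ M := (norm_nonneg _).trans (hM 0 ⟨le_rfl, ht⟩)
  rw [intervalIntegrable_iff_integrableOn_Ioc_of_le ht]
  refine Integrable.mono' (g := fun _ => lam * (M * ∫ u in (0 : ℝ)..t, b u))
    (integrable_const _) ?_ ?_
  · exact ContinuousOn.aestronglyMeasurable
      (fun x hx => (hs.continuousAt_deriv hb hx.1).continuousWithinAt) measurableSet_Ioc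
  · filter_upwards [ae_restrict_mem measurableSet_Ioc] with τ hτ
    rw [hs.deriv_eq hτ.1, norm_neg, norm_mul, Real.norm_eq_abs, abs_of_pos hl, Real.norm_eq_abs]
    refine mul_le_mul_of_nonneg_left ((hb.abs_conv_le hτ.1.le fun u hu =>
      hM u ⟨hu.1, hu.2.trans hτ.2⟩).trans ?_) hl.le
    refine mul_le_mul_of_nonneg_left ?_ hM0
    rw [intervalIntegral.integral_of_le ht, intervalIntegral.integral_of_le hτ.1.le]
    refine setIntegral_mono_set ((intervalIntegrable_iff_integrableOn_Ioc_of_le ht).1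
      (hb.intervalIntegrable ht)) ?_ (Ioc_subset_Ioc_right hτ.2).eventuallyLE
    filter_upwards [ae_restrict_mem measurableSet_Ioc] with u hu
    exact hb.nonneg u hu.1

theorem IsScalarSolution.abs_le_one (hs : IsScalarSolution b lam s s')
    (hb : Assumption1 b b' ρ) (hl : 0 < lam) {t : ℝ} (ht : 0 ≤ t) : |s t| ≤ 1 := by
  have hc : ContinuousOn s (Icc 0 t) := hs.cont.mono Icc_subset_Ici_self
  have hi : IntervalIntegrable (fun τ => 2 * (s τ * s' τ)) volume 0 t :=
    ((hs.intervalIntegrable_deriv hb hl ht).continuousOn_mul (by rwa [uIcc_of_le ht])).const_mul 2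
  have h1 := intervalIntegral.integral_eq_sub_of_hasDerivAt_of_le ht (hc.pow 2)
    (f' := fun τ => 2 * (s τ * s' τ)) (fun τ hτ =>
      ((hs.hasDeriv τ hτ.1).pow 2).congr_deriv (by push_cast; ring)) hi
  have h2 : ∫ τ in (0 : ℝ)..t, 2 * (s τ * s' τ) =
      -(2 * lam) * ∫ τ in (0 : ℝ)..t, s τ * ∫ u in (0 : ℝ)..τ, b (τ - u) * s u := by
    rw [← intervalIntegral.integral_const_mul, intervalIntegral.integral_of_le ht,
      intervalIntegral.integral_of_le ht]
    refine setIntegral_congr_fun measurableSet_Ioc fun τ hτ => ?_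
    rw [hs.deriv_eq hτ.1]; ring
  have h3 := mul_nonneg hl.le (hb.positive_type ht hc)
  rw [Pi.pow_apply, Pi.pow_apply, hs.init] at h1
  rw [abs_le_one_iff_mul_self_le_one]
  nlinarith

end ScalarSolution

section Laplace

theorem laplace_conv {z : ℂ} {p q : ℝ → ℝ}
    (hp : IntegrableOn (fun t : ℝ => Complex.exp (-z * t) * p t) (Ioi 0))
    (hq : IntegrableOn (fun t : ℝ => Complex.exp (-z * t) * q t) (Ioi 0)) :
    IntegrableOn (fun t : ℝ => Complex.exp (-z * t) *
      ((∫ u in (0 : ℝ)..t, q (t - u) * p u : ℝ) : ℂ)) (Ioi 0) ∧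
    ∫ t in Ioi (0 : ℝ), Complex.exp (-z * t) * ((∫ u in (0 : ℝ)..t, q (t - u) * p u : ℝ) : ℂ) =
      (∫ t in Ioi (0 : ℝ), Complex.exp (-z * t) * p t) *
        ∫ t in Ioi (0 : ℝ), Complex.exp (-z * t) * q t := by
  have hpt : ∀ t : ℝ, ∫ u in (0 : ℝ)..t, ContinuousLinearMap.mul ℝ ℂ
      (Complex.exp (-z * u) * p u) (Complex.exp (-z * (t - u : ℝ)) * q (t - u)) =
      Complex.exp (-z * t) * ((∫ u in (0 : ℝ)..t, q (t - u) * p u : ℝ) : ℂ) := by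
    intro t
    rw [← intervalIntegral.integral_ofReal, ← intervalIntegral.integral_const_mul]
    refine intervalIntegral.integral_congr fun u _ => ?_
    simp only [ContinuousLinearMap.mul_apply']
    rw [show -z * (t : ℂ) = -z * u + -z * (t - u : ℝ) by push_cast; ring, Complex.exp_add]
    push_cast
    ring
  have h1 := integral_posConvolution hp hq (ContinuousLinearMap.mul ℝ ℂ)
  have h2 := integrable_posConvolution hp hq (ContinuousLinearMap.mul ℝ ℂ)
  rw [posConvolution, integrable_indicator_iff measurableSet_Ioi] at h2
  simp only [hpt] at h1 h2
  simp only [ContinuousLinearMap.mul_apply'] at h1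
  exact ⟨h2, h1⟩

variable {b b' s s' : ℝ → ℝ} {ρ lam : ℝ}

theorem IsScalarSolution.conv_mul_eq (hs : IsScalarSolution b lam s s')
    (hb : Assumption1 b b' ρ) {t : ℝ} (ht : 0 < t) :
    t * s' t = -lam * ((∫ u in (0 : ℝ)..t, b (t - u) * (u * s u)) +
      ∫ u in (0 : ℝ)..t, (t - u) * b (t - u) * s u) := by
  have hc : ContinuousOn s (Icc 0 t) := hs.cont.mono Icc_subset_Ici_self
  have h1 := hb.intervalIntegrable_conv (s := fun u => u * s u) ht.le (by fun_prop)
  have h2 := hb.intervalIntegrable_conv (s := fun u => (t - u) * s u) ht.le (by fun_prop)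
  have h3 : ∀ u, (t - u) * b (t - u) * s u = b (t - u) * ((t - u) * s u) := fun u => by ring
  simp only [h3]
  rw [← intervalIntegral.integral_add h1 h2, hs.deriv_eq ht]
  have h4 : ∀ u, b (t - u) * (u * s u) + b (t - u) * ((t - u) * s u) = t * (b (t - u) * s u) :=
    fun u => by ring
  simp only [h4]
  rw [intervalIntegral.integral_const_mul]
  ring

theorem tendsto_exp_neg_mul_mul {z : ℂ} (hz : 0 < z.re) :
    Tendsto (fun t : ℝ => (2 / z.re) * Real.exp (-(z.re / 2) * t)) atTop (nhds 0) := by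
  have : Tendsto (fun t : ℝ => -(z.re / 2) * t) atTop atBot :=
    tendsto_id.const_mul_atTop_of_neg (by linarith)
  simpa using (Real.tendsto_exp_atBot.comp this).const_mul (2 / z.re)

/-- The Laplace transform of `t s'(t)`. -/
theorem IsScalarSolution.laplace_mul_deriv (hs : IsScalarSolution b lam s s')
    (hb : Assumption1 b b' ρ) (hl : 0 < lam) {z : ℂ} (hz : 0 < z.re) :
    IntegrableOn (fun t : ℝ => Complex.exp (-z * t) * ((t * s' t : ℝ) : ℂ)) (Ioi 0) ∧
    (∫ t in Ioi (0 : ℝ), Complex.exp (-z * t) * ((t * s' t : ℝ) : ℂ)) *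
      (z + lam * laplaceTransform b z) ^ 2 =
      -lam * (z * (∫ t in Ioi (0 : ℝ), b t • ((t : ℂ) * Complex.exp (-z * t))) +
        laplaceTransform b z) := by
  have hle : ∀ t > 0, |s t| ≤ 1 := fun t ht => hs.abs_le_one hb hl (le_of_lt ht)
  have hsm : AEStronglyMeasurable (fun t : ℝ => (s t : ℂ)) (volume.restrict (Ioi 0)) :=
    Complex.continuous_ofReal.comp_aestronglyMeasurable
      ((hs.cont.mono Ioi_subset_Ici_self).aestronglyMeasurable measurableSet_Ioi)
  have hem : AEStronglyMeasurable (fun t : ℝ => Complex.exp (-z * t))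
      (volume.restrict (Ioi 0)) := by fun_prop
  have i0 : IntegrableOn (fun t : ℝ => Complex.exp (-z * t) * s t) (Ioi 0) := by
    refine (exp_neg_integrableOn_Ioi 0 hz).mono' (hem.mul hsm) ?_
    filter_upwards [ae_restrict_mem measurableSet_Ioi] with t ht
    rw [norm_mul, norm_exp_neg_mul, Complex.norm_real]
    exact mul_le_of_le_one_right (Real.exp_pos _).le (hle t ht)
  have i1 : IntegrableOn (fun t : ℝ => Complex.exp (-z * t) * ((t * s t : ℝ) : ℂ)) (Ioi 0) := by
    refine ((exp_neg_integrableOn_Ioi 0 (half_pos hz)).const_mul (2 / z.re)).mono' ?_ ?_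
    · simp only [Complex.ofReal_mul]
      exact hem.mul ((by fun_prop : AEStronglyMeasurable (fun t : ℝ => (t : ℂ))
        (volume.restrict (Ioi 0))).mul hsm)
    filter_upwards [ae_restrict_mem measurableSet_Ioi] with t ht
    rw [Complex.ofReal_mul, ← mul_assoc, norm_mul, mul_comm (Complex.exp _), Complex.norm_real]
    exact (mul_le_of_le_one_right (norm_nonneg _) (hle t ht)).trans
      (norm_mul_exp_neg_mul_le hz (le_of_lt ht))
  have j0 : IntegrableOn (fun t : ℝ => Complex.exp (-z * t) * b t) (Ioi 0) := by
    simpa only [Complex.real_smul, mul_comm] using hb.integrableOn_smul_exp hz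
  have e1 : ∀ t : ℝ, Complex.exp (-z * t) * ((t * b t : ℝ) : ℂ) =
      b t • ((t : ℂ) * Complex.exp (-z * t)) := fun t => by
    rw [Complex.real_smul]; push_cast; ring
  have j1 : IntegrableOn (fun t : ℝ => Complex.exp (-z * t) * ((t * b t : ℝ) : ℂ)) (Ioi 0) := by
    simpa only [e1] using hb.integrableOn_smul_mul_exp hz
  obtain ⟨c0, C0⟩ := laplace_conv i0 j0
  obtain ⟨c1, C1⟩ := laplace_conv i1 j0
  obtain ⟨c2, C2⟩ := laplace_conv i0 j1
  simp only [← e1]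
  simp only [laplaceTransform]
  set B0 := ∫ t in Ioi (0 : ℝ), Complex.exp (-z * t) * (b t : ℂ)
  set B1 := ∫ t in Ioi (0 : ℝ), Complex.exp (-z * t) * ((t * b t : ℝ) : ℂ)
  set S0 := ∫ t in Ioi (0 : ℝ), Complex.exp (-z * t) * (s t : ℂ)
  set S1 := ∫ t in Ioi (0 : ℝ), Complex.exp (-z * t) * ((t * s t : ℝ) : ℂ)
  have hd : ∀ t ∈ Ioi (0 : ℝ), Complex.exp (-z * t) * (s' t : ℂ) = -lam *
      (Complex.exp (-z * t) * ((∫ u in (0 : ℝ)..t, b (t - u) * s u : ℝ) : ℂ)) := fun t ht => by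
    rw [hs.deriv_eq ht]; push_cast; ring
  have htd : ∀ t ∈ Ioi (0 : ℝ), Complex.exp (-z * t) * ((t * s' t : ℝ) : ℂ) = -lam *
      (Complex.exp (-z * t) * ((∫ u in (0 : ℝ)..t, b (t - u) * (u * s u) : ℝ) : ℂ) +
      Complex.exp (-z * t) * ((∫ u in (0 : ℝ)..t, (t - u) * b (t - u) * s u : ℝ) : ℂ)) :=
    fun t ht => by
    rw [hs.conv_mul_eq hb ht]; push_cast; ring
  have k0 : IntegrableOn (fun t : ℝ => Complex.exp (-z * t) * (s' t : ℂ)) (Ioi 0) :=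
    IntegrableOn.congr_fun (c0.const_mul (-(lam : ℂ))) (fun t ht => (hd t ht).symm)
      measurableSet_Ioi
  have K0 : ∫ t in Ioi (0 : ℝ), Complex.exp (-z * t) * (s' t : ℂ) = -lam * (S0 * B0) := by
    rw [setIntegral_congr_fun measurableSet_Ioi hd, integral_const_mul, C0]
  have k1 : IntegrableOn (fun t : ℝ => Complex.exp (-z * t) * ((t * s' t : ℝ) : ℂ)) (Ioi 0) :=
    IntegrableOn.congr_fun ((c1.add c2).const_mul (-(lam : ℂ))) (fun t ht => (htd t ht).symm)
      measurableSet_Ioi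
  have K1 : ∫ t in Ioi (0 : ℝ), Complex.exp (-z * t) * ((t * s' t : ℝ) : ℂ) =
      -lam * (S1 * B0 + S0 * B1) := by
    rw [setIntegral_congr_fun measurableSet_Ioi htd, integral_const_mul, integral_add c1 c2, C1, C2]
  have hexp : ∀ t : ℝ, HasDerivAt (fun t : ℝ => Complex.exp (-z * t))
      (Complex.exp (-z * t) * -z) t := fun t => by
    have h0 : HasDerivAt (fun t : ℝ => (t : ℂ)) 1 t := Complex.ofRealCLM.hasDerivAt
    exact ((h0.const_mul (-z)).cexp).congr_deriv (by ring)
  have hcs : ContinuousWithinAt (fun t : ℝ => (s t : ℂ)) (Ici 0) 0 :=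
    Complex.continuous_ofReal.continuousAt.comp_continuousWithinAt (hs.cont 0 self_mem_Ici)
  have hsd : ∀ t ∈ Ioi (0 : ℝ), HasDerivAt (fun t : ℝ => (s t : ℂ)) (s' t : ℂ) t :=
    fun t ht => (hs.hasDeriv t ht).ofReal_comp
  have hlim : ∀ φ : ℝ → ℂ, (∀ t > 0, ‖φ t‖ ≤ (2 / z.re) * Real.exp (-(z.re / 2) * t)) →
      Tendsto φ atTop (nhds 0) := fun φ hφ =>
    squeeze_zero_norm' ((eventually_gt_atTop 0).mono hφ) (tendsto_exp_neg_mul_mul hz)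
  have hl1 : Tendsto (fun t : ℝ => (t : ℂ) * Complex.exp (-z * t) * s t) atTop (nhds 0) :=
    hlim _ fun t ht => by
      rw [norm_mul, Complex.norm_real]
      exact (mul_le_of_le_one_right (norm_nonneg _) (hle t ht)).trans
        (norm_mul_exp_neg_mul_le hz (le_of_lt ht))
  have hl0 : Tendsto (fun t : ℝ => Complex.exp (-z * t) * s t) atTop (nhds 0) := by
    refine squeeze_zero_norm' ?_ (tendsto_exp_neg_mul_mul hz)
    filter_upwards [eventually_ge_atTop 1] with t ht
    rw [norm_mul, Complex.norm_real]
    refine (mul_le_of_le_one_right (norm_nonneg _) (hle t (by linarith))).trans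
      (le_trans ?_ (norm_mul_exp_neg_mul_le hz (by linarith : 0 ≤ t)))
    rw [norm_mul, Complex.norm_real, Real.norm_eq_abs, abs_of_nonneg (by linarith)]
    exact le_mul_of_one_le_left (norm_nonneg _) ht
  have F0 : -z * S0 + -lam * (S0 * B0) = -1 := by
    have h := integral_Ioi_of_hasDerivAt_of_tendsto (a := 0)
      (f := fun t : ℝ => Complex.exp (-z * t) * s t)
      (f' := fun t : ℝ => -z * (Complex.exp (-z * t) * s t) + Complex.exp (-z * t) * s' t)
      (((hexp 0).continuousAt.continuousWithinAt).mul hcs)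
      (fun t ht => ((hexp t).mul (hsd t ht)).congr_deriv (by ring)) ((i0.const_mul _).add k0) hl0
    rw [integral_add (i0.const_mul _) k0, integral_const_mul, K0] at h
    have h1 : Complex.exp (-z * (0 : ℝ)) * (s 0 : ℂ) = 1 := by simp [hs.init]
    rw [h1] at h
    change -z * S0 + -lam * (S0 * B0) = 0 - 1 at h
    linear_combination h
  have F1 : S0 + -z * S1 + -lam * (S1 * B0 + S0 * B1) = 0 := by
    have h0 : ∀ t : ℝ, HasDerivAt (fun t : ℝ => (t : ℂ)) 1 t := fun t =>
      Complex.ofRealCLM.hasDerivAt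
    have i01 : IntegrableOn (fun t : ℝ => Complex.exp (-z * t) * s t +
        -z * (Complex.exp (-z * t) * ((t * s t : ℝ) : ℂ))) (Ioi 0) := i0.add (i1.const_mul (-z))
    have h := integral_Ioi_of_hasDerivAt_of_tendsto (a := 0)
      (f := fun t : ℝ => (t : ℂ) * Complex.exp (-z * t) * s t)
      (f' := fun t : ℝ => Complex.exp (-z * t) * s t +
        -z * (Complex.exp (-z * t) * ((t * s t : ℝ) : ℂ)) +
        Complex.exp (-z * t) * ((t * s' t : ℝ) : ℂ))
      ((((h0 0).mul (hexp 0)).continuousAt.continuousWithinAt).mul hcs)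
      (fun t ht => (((h0 t).mul (hexp t)).mul (hsd t ht)).congr_deriv (by
        simp only [Pi.mul_apply]; push_cast; ring))
      (i01.add k1) hl1
    rw [integral_add i01 k1, integral_add i0 (i1.const_mul _),
      integral_const_mul, K1] at h
    simp only [Complex.ofReal_zero, zero_mul, sub_zero] at h
    exact h
  refine ⟨k1, ?_⟩
  rw [K1]
  have G0 : S0 * (z + lam * B0) = 1 := by linear_combination -F0
  have G1 : S1 * (z + lam * B0) = S0 * (1 - lam * B1) := by linear_combination -F1
  linear_combination (-lam * B0 * (z + lam * B0)) * G1 + (-lam * (z * B1 + B0)) * G0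

end Laplace

section DerivativeBound

variable {b b' s s' : ℝ → ℝ} {ρ lam : ℝ}

theorem Assumption1.exists_norm_laplaceTransform_le (hb : Assumption1 b b' ρ) {a : ℝ} (ha : 0 < a) :
    ∃ M > 0, ∀ z : ℂ, a ≤ z.re → ‖laplaceTransform b z‖ ≤ M := by
  have hi : IntegrableOn (fun t => b t • Real.exp (-a * t)) (Ioi 0) :=
    hb.integrableOn_smul (by fun_prop) (M := 1) ha fun t _ => by
      rw [Real.norm_eq_abs, abs_of_pos (Real.exp_pos _), one_mul]
  refine ⟨(∫ t in Ioi 0, b t • Real.exp (-a * t)) + 1, ?_, fun z hz => ?_⟩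
  · have : 0 ≤ ∫ t in Ioi 0, b t • Real.exp (-a * t) :=
      setIntegral_nonneg measurableSet_Ioi fun t ht =>
        mul_nonneg (hb.nonneg t ht) (Real.exp_pos _).le
    linarith
  · rw [laplaceTransform_eq_integral_smul]
    refine (norm_integral_le_of_norm_le hi ?_).trans (by linarith)
    filter_upwards [ae_restrict_mem measurableSet_Ioi] with t ht
    have ht : 0 < t := ht
    rw [norm_smul, norm_exp_neg_mul, Real.norm_eq_abs, abs_of_nonneg (hb.nonneg t ht), smul_eq_mul]
    refine mul_le_mul_of_nonneg_left (Real.exp_le_exp.2 ?_) (hb.nonneg t ht)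
    nlinarith

theorem Assumption1.exists_norm_laplace_mul_deriv_le (hb : Assumption1 b b' ρ) {ε T : ℝ}
    (hε : 0 ≤ ε) (hε1 : ε ≤ 1) (hT : 0 < T) :
    ∃ D > 0, ∀ lam > 0, ∀ s s' : ℝ → ℝ, IsScalarSolution b lam s s' → ∀ z : ℂ, T⁻¹ ≤ z.re →
      ‖∫ t in Ioi (0 : ℝ), Complex.exp (-z * t) * ((t * s' t : ℝ) : ℂ)‖ ≤
        D * lam ^ ε * ‖z‖ ^ (-(1 + ε)) := by
  obtain ⟨C, hC, hreg⟩ := hb.exists_regularity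
  obtain ⟨κ, hκ, hsec⟩ := hb.exists_sector
  obtain ⟨M, hM, hbd⟩ := hb.exists_norm_laplaceTransform_le (inv_pos.2 hT)
  set D1 := (C + 1) / κ * (1 + 1 / κ) with hD1
  set D2 := (C + 1) * M * (1 + 1 / κ) ^ 2 with hD2
  refine ⟨max D1 D2, by positivity, fun lam hl s s' hs z hz => ?_⟩
  have hz0 : 0 < z.re := (inv_pos.2 hT).trans_le hz
  obtain ⟨-, hF⟩ := hs.laplace_mul_deriv hb hl hz0
  set F := ∫ t in Ioi (0 : ℝ), Complex.exp (-z * t) * ((t * s' t : ℝ) : ℂ)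
  set B := laplaceTransform b z
  set w := z + lam * B
  have hzn : 0 < ‖z‖ := hz0.trans_le (Complex.re_le_norm z)
  have hw1 : lam * κ * ‖B‖ ≤ ‖w‖ := by
    refine le_trans ?_ (Complex.re_le_norm w)
    have : w.re = z.re + lam * B.re := by simp [w]
    rw [this, mul_assoc]
    have := mul_le_mul_of_nonneg_left (hsec z hz0) hl.le
    linarith
  have hw2 : ‖z‖ ≤ (1 + 1 / κ) * ‖w‖ := by
    have h1 : z = w - lam * B := by simp [w]
    have h2 : ‖(lam : ℂ) * B‖ = lam * ‖B‖ := by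
      rw [norm_mul, Complex.norm_real, Real.norm_eq_abs, abs_of_pos hl]
    have h3 : lam * ‖B‖ ≤ 1 / κ * ‖w‖ := by
      rw [div_mul_eq_mul_div, one_mul, le_div_iff₀ hκ]; linarith
    calc ‖z‖ ≤ ‖w‖ + ‖(lam : ℂ) * B‖ := by
          conv_lhs => rw [h1]
          exact norm_sub_le _ _
      _ ≤ _ := by rw [h2]; linarith
  have hwn : 0 < ‖w‖ := by
    by_contra! h
    have : ‖w‖ = 0 := le_antisymm h (norm_nonneg _)
    rw [this, mul_zero] at hw2
    linarith
  have hF2 : ‖F‖ * ‖w‖ ^ 2 ≤ lam * ((C + 1) * ‖B‖) := by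
    rw [← norm_pow, ← norm_mul, hF, norm_mul, norm_neg, Complex.norm_real, Real.norm_eq_abs,
      abs_of_pos hl]
    refine mul_le_mul_of_nonneg_left ((norm_add_le _ _).trans ?_) hl.le
    have := hreg z hz0
    linarith
  have hB1 : ‖F‖ ≤ max D1 D2 / ‖z‖ := by
    have h1 : ‖F‖ * ‖w‖ ≤ (C + 1) / κ := by
      rw [le_div_iff₀ hκ]
      have : ‖F‖ * ‖w‖ * κ * ‖w‖ ≤ (C + 1) * ‖w‖ := by
        calc ‖F‖ * ‖w‖ * κ * ‖w‖ = κ * (‖F‖ * ‖w‖ ^ 2) := by ring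
          _ ≤ κ * (lam * ((C + 1) * ‖B‖)) := by gcongr
          _ = (C + 1) * (lam * κ * ‖B‖) := by ring
          _ ≤ _ := by gcongr
      exact le_of_mul_le_mul_right this hwn
    rw [le_div_iff₀ hzn]
    calc ‖F‖ * ‖z‖ ≤ ‖F‖ * ((1 + 1 / κ) * ‖w‖) := by gcongr
      _ = ‖F‖ * ‖w‖ * (1 + 1 / κ) := by ring
      _ ≤ D1 := by rw [hD1]; gcongr
      _ ≤ _ := le_max_left _ _
  have hB2 : ‖F‖ ≤ max D1 D2 * lam / ‖z‖ ^ 2 := by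
    rw [le_div_iff₀ (by positivity)]
    calc ‖F‖ * ‖z‖ ^ 2 ≤ ‖F‖ * ((1 + 1 / κ) * ‖w‖) ^ 2 := by gcongr
      _ = ‖F‖ * ‖w‖ ^ 2 * (1 + 1 / κ) ^ 2 := by ring
      _ ≤ lam * ((C + 1) * ‖B‖) * (1 + 1 / κ) ^ 2 := by gcongr
      _ ≤ lam * ((C + 1) * M) * (1 + 1 / κ) ^ 2 := by gcongr; exact hbd z hz
      _ = D2 * lam := by rw [hD2]; ring
      _ ≤ _ := by gcongr; exact le_max_right _ _
  have hD : 0 < max D1 D2 := by positivity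
  set D := max D1 D2
  rcases (norm_nonneg F).eq_or_lt with h0 | h0
  · rw [← h0]; positivity
  calc ‖F‖ = ‖F‖ ^ (1 - ε) * ‖F‖ ^ ε := by
        rw [← Real.rpow_add h0, sub_add_cancel, Real.rpow_one]
    _ ≤ (D / ‖z‖) ^ (1 - ε) * (D * lam / ‖z‖ ^ 2) ^ ε := by
        gcongr
    _ = (D ^ (1 - ε) * D ^ ε) * lam ^ ε * (‖z‖ ^ (-(1 - ε)) * ‖z‖ ^ (-(2 * ε))) := by
        rw [Real.div_rpow hD.le hzn.le, Real.div_rpow (by positivity) (by positivity),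
          Real.mul_rpow hD.le hl.le, ← Real.rpow_natCast, ← Real.rpow_mul hzn.le,
          Real.rpow_neg hzn.le, Real.rpow_neg hzn.le]
        push_cast
        field_simp
    _ = _ := by
        rw [← Real.rpow_add hD, ← Real.rpow_add hzn, sub_add_cancel, Real.rpow_one]
        congr 2
        ring

open FourierTransform in
/-- Pointwise bound `|s_λ'(t)| ≤ C λ^ε t^{ε-1}`, with `C` independent of `λ`. -/
theorem Assumption1.exists_abs_deriv_le (hb : Assumption1 b b' ρ) {ε T : ℝ}
    (hε : 0 < ε) (hε1 : ε ≤ 1) (hT : 0 < T) :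
    ∃ C > 0, ∀ lam > 0, ∀ s s' : ℝ → ℝ, IsScalarSolution b lam s s' → ∀ t ∈ Ioc 0 T,
      |s' t| ≤ C * lam ^ ε * t ^ (ε - 1) := by
  obtain ⟨D, hD, hbd⟩ := hb.exists_norm_laplace_mul_deriv_le hε.le hε1 hT
  have hJi : Integrable (fun x : ℝ => (1 + ‖x‖ ^ 2) ^ (-(1 + ε) / 2)) :=
    integrable_rpow_neg_one_add_norm_sq (by simpa using hε)
  set J := ∫ x : ℝ, (1 + ‖x‖ ^ 2) ^ (-(1 + ε) / 2) with hJ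
  have hJ0 : 0 ≤ J := integral_nonneg fun x => by positivity
  refine ⟨Real.exp 1 * D * (J + 1), by positivity, fun lam hl s s' hs t ht => ?_⟩
  have ht0 : 0 < t := ht.1
  have hre : ∀ ξ : ℝ, (((t⁻¹ : ℝ) : ℂ) + ((2 * Real.pi * ξ : ℝ) : ℂ) * Complex.I).re = t⁻¹ :=
    fun ξ => by simp
  have him : ∀ ξ : ℝ, (((t⁻¹ : ℝ) : ℂ) + ((2 * Real.pi * ξ : ℝ) : ℂ) * Complex.I).im =
    2 * Real.pi * ξ := fun ξ => by simp
  set f : ℝ → ℂ := (Ioi 0).indicator fun u : ℝ =>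
    Complex.exp (-((t⁻¹ : ℝ) : ℂ) * u) * ((u * s' u : ℝ) : ℂ) with hf
  have hfi : Integrable f := (integrable_indicator_iff measurableSet_Ioi).2
    (hs.laplace_mul_deriv hb hl (z := ((t⁻¹ : ℝ) : ℂ)) (by simpa using ht0)).1
  have hFf : ∀ ξ, 𝓕 f ξ = ∫ u in Ioi (0 : ℝ), Complex.exp
      (-(((t⁻¹ : ℝ) : ℂ) + ((2 * Real.pi * ξ : ℝ) : ℂ) * Complex.I) * u) *
        ((u * s' u : ℝ) : ℂ) := by
    intro ξ
    rw [Real.fourier_eq', ← integral_indicator measurableSet_Ioi]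
    congr 1
    ext u
    by_cases hu : u ∈ Ioi (0 : ℝ)
    · rw [hf, indicator_of_mem hu, indicator_of_mem hu, smul_eq_mul, ← mul_assoc, ← Complex.exp_add]
      congr 2
      simp only [RCLike.inner_apply, conj_trivial]
      push_cast
      ring
    · rw [hf, indicator_of_notMem hu, indicator_of_notMem hu, smul_zero]
  have hFbd : ∀ ξ, ‖𝓕 f ξ‖ ≤ D * lam ^ ε * (t ^ (1 + ε) * (1 + ‖t * ξ‖ ^ 2) ^ (-(1 + ε) / 2)) := by
    intro ξ
    rw [hFf]
    refine (hbd lam hl s s' hs _ ?_).trans ?_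
    · rw [hre]; exact inv_anti₀ ht0 ht.2
    refine mul_le_mul_of_nonneg_left ?_ (by positivity)
    set z : ℂ := ((t⁻¹ : ℝ) : ℂ) + ((2 * Real.pi * ξ : ℝ) : ℂ) * Complex.I with hz
    have h1 : (t⁻¹ * (1 + ‖t * ξ‖ ^ 2) ^ (1 / 2 : ℝ)) ≤ ‖z‖ := by
      rw [← Real.sqrt_eq_rpow, Complex.norm_eq_sqrt_sq_add_sq, hre, him]
      refine Real.le_sqrt_of_sq_le ?_
      rw [mul_pow, Real.sq_sqrt (by positivity), Real.norm_eq_abs, sq_abs]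
      have : t⁻¹ ^ 2 * (1 + (t * ξ) ^ 2) = t⁻¹ ^ 2 + ξ ^ 2 := by field_simp
      rw [this]
      have := Real.pi_gt_three
      nlinarith [sq_nonneg ξ, mul_nonneg (sq_nonneg ξ) (by nlinarith : 0 ≤ (2 * Real.pi) ^ 2 - 1)]
    calc ‖z‖ ^ (-(1 + ε)) ≤ (t⁻¹ * (1 + ‖t * ξ‖ ^ 2) ^ (1 / 2 : ℝ)) ^ (-(1 + ε)) :=
          Real.rpow_le_rpow_of_nonpos (by positivity) h1 (by linarith)
      _ = _ := by
          rw [Real.mul_rpow (by positivity) (by positivity), Real.inv_rpow ht0.le,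
            ← Real.rpow_neg ht0.le, neg_neg, ← Real.rpow_mul (by positivity)]
          congr 2
          ring
  have hgi : Integrable fun ξ : ℝ =>
      D * lam ^ ε * (t ^ (1 + ε) * (1 + ‖t * ξ‖ ^ 2) ^ (-(1 + ε) / 2)) :=
    ((hJi.comp_mul_left' ht0.ne').const_mul _).const_mul _
  have hFc : Continuous (𝓕 f) :=
    VectorFourier.fourierIntegral_continuous Real.continuous_fourierChar
      (by exact continuous_inner) hfi
  have hFi : Integrable (𝓕 f) := hgi.mono' hFc.aestronglyMeasurable (ae_of_all _ hFbd)
  have hfc : ContinuousAt f t := by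
    have h1 : ContinuousAt (fun u : ℝ =>
        Complex.exp (-((t⁻¹ : ℝ) : ℂ) * u) * ((u * s' u : ℝ) : ℂ)) t := by
      have := hs.continuousAt_deriv hb ht0
      fun_prop
    refine h1.congr ?_
    filter_upwards [Ioi_mem_nhds ht0] with u hu
    rw [hf, indicator_of_mem (show u ∈ Ioi 0 from hu)]
  have hinv := hfi.fourierInv_fourier_eq hFi hfc
  have hft : ‖f t‖ = Real.exp (-1) * (t * |s' t|) := by
    rw [hf, indicator_of_mem (show t ∈ Ioi 0 from ht0), norm_mul, norm_exp_neg_mul,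
      Complex.norm_real, Real.norm_eq_abs, abs_mul, abs_of_pos ht0, Complex.ofReal_re,
      neg_mul, inv_mul_cancel₀ ht0.ne']
  have hmain : Real.exp (-1) * (t * |s' t|) ≤ D * lam ^ ε * (t ^ ε * J) := by
    rw [← hft, ← hinv, Real.fourierInv_eq']
    refine (norm_integral_le_of_norm_le hgi (ae_of_all _ fun ξ => ?_)).trans_eq ?_
    · rw [norm_smul, Complex.norm_exp_ofReal_mul_I, one_mul]
      exact hFbd ξ
    · rw [integral_const_mul, integral_const_mul,
        Measure.integral_comp_mul_left (fun x : ℝ => (1 + ‖x‖ ^ 2) ^ (-(1 + ε) / 2)) t,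
        abs_of_pos (inv_pos.2 ht0), smul_eq_mul, ← hJ, Real.rpow_add ht0, Real.rpow_one]
      field_simp
  have h2 : t * |s' t| ≤ Real.exp 1 * (D * lam ^ ε * (t ^ ε * J)) := by
    have := mul_le_mul_of_nonneg_left hmain (Real.exp_pos 1).le
    rwa [← mul_assoc, ← Real.exp_add, add_neg_cancel, Real.exp_zero, one_mul] at this
  rw [Real.rpow_sub_one ht0.ne', ← mul_div_assoc, le_div_iff₀ ht0, mul_comm]
  refine h2.trans ?_
  calc Real.exp 1 * (D * lam ^ ε * (t ^ ε * J)) = Real.exp 1 * D * J * lam ^ ε * t ^ ε := by ring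
    _ ≤ _ := by gcongr; linarith

end DerivativeBound

section Energy

variable {b b' : ℝ → ℝ} {ρ : ℝ}

/-- Energy estimate for finite systems of scalar Volterra equations with forcing. -/
theorem Assumption1.energy_estimate (hb : Assumption1 b b' ρ) {ι : Type*} [Fintype ι]
    {μ : ι → ℝ} (hμ : ∀ j, 0 < μ j) {θ θ' q : ι → ℝ → ℝ} {G : ℝ → ℝ} {T : ℝ} (hT : 0 ≤ T)
    (hθ : ∀ j, ContinuousOn (θ j) (Icc 0 T)) (hd : ∀ j, ∀ t > 0, HasDerivAt (θ j) (θ' j t) t)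
    (hi : ∀ j, IntervalIntegrable (θ' j) volume 0 T)
    (hq : ∀ j, IntervalIntegrable (q j) volume 0 T)
    (heq : ∀ j, ∀ t > 0, θ' j t = -(μ j * ∫ u in (0 : ℝ)..t, b (t - u) * θ j u) - q j t)
    (hG : IntervalIntegrable G volume 0 T) (hG0 : ∀ t ∈ Ioc 0 T, 0 ≤ G t)
    (hqG : ∀ t ∈ Ioc 0 T, √(∑ j, q j t ^ 2) ≤ G t) {t : ℝ} (ht : t ∈ Icc 0 T) :
    √(∑ j, θ j t ^ 2) ≤ √(∑ j, θ j 0 ^ 2) + 2 * ∫ u in (0 : ℝ)..T, G u := by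
  have hYc : ContinuousOn (fun t => √(∑ j, θ j t ^ 2)) (Icc 0 T) :=
    (continuousOn_finsetSum _ fun j _ => (hθ j).pow 2).sqrt
  obtain ⟨τ, hτ, hmax⟩ := isCompact_Icc.exists_isMaxOn ⟨0, left_mem_Icc.2 hT⟩ hYc
  have hmax : ∀ u ∈ Icc 0 T, √(∑ j, θ j u ^ 2) ≤ √(∑ j, θ j τ ^ 2) := fun u hu => hmax hu
  refine (hmax t ht).trans ?_
  set m := √(∑ j, θ j τ ^ 2) with hm
  have hm0 : 0 ≤ m := Real.sqrt_nonneg _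
  have hsub : ∀ {f : ℝ → ℝ}, IntervalIntegrable f volume 0 T → IntervalIntegrable f volume 0 τ :=
    fun hf => hf.mono_set (by rw [uIcc_of_le hτ.1, uIcc_of_le hT]; exact Icc_subset_Icc_right hτ.2)
  have hθτ : ∀ j, ContinuousOn (θ j) (Icc 0 τ) := fun j => (hθ j).mono (Icc_subset_Icc_right hτ.2)
  have hj : ∀ j, θ j τ ^ 2 ≤ θ j 0 ^ 2 + 2 * ∫ u in (0 : ℝ)..τ, -(θ j u * q j u) := by
    intro j
    have hc : ContinuousOn (θ j) (uIcc 0 τ) := by rw [uIcc_of_le hτ.1]; exact hθτ j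
    have hi1 : IntervalIntegrable (fun u => θ j u * θ' j u) volume 0 τ :=
      (hsub (hi j)).continuousOn_mul hc
    have hi2 : IntervalIntegrable (fun u => θ j u * q j u) volume 0 τ :=
      (hsub (hq j)).continuousOn_mul hc
    have h1 := intervalIntegral.integral_eq_sub_of_hasDerivAt_of_le hτ.1 ((hθτ j).pow 2)
      (f' := fun u => 2 * (θ j u * θ' j u)) (fun u hu =>
        ((hd j u hu.1).pow 2).congr_deriv (by push_cast; ring)) (hi1.const_mul 2)
    rw [intervalIntegral.integral_const_mul, Pi.pow_apply, Pi.pow_apply] at h1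
    have h2 : ∫ u in (0 : ℝ)..τ, (-(θ j u * q j u) - θ j u * θ' j u) =
        μ j * ∫ u in (0 : ℝ)..τ, θ j u * ∫ v in (0 : ℝ)..u, b (u - v) * θ j v := by
      rw [← intervalIntegral.integral_const_mul, intervalIntegral.integral_of_le hτ.1,
        intervalIntegral.integral_of_le hτ.1]
      refine setIntegral_congr_fun measurableSet_Ioc fun u hu => ?_
      simp only [heq j u hu.1]
      ring
    have hi3 : IntervalIntegrable (fun u => -(θ j u * q j u)) volume 0 τ := hi2.neg
    rw [intervalIntegral.integral_sub hi3 hi1] at h2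
    have h3 := mul_nonneg (hμ j).le (hb.positive_type hτ.1 (hθτ j))
    linarith
  have hi2 : ∀ j, IntervalIntegrable (fun u => -(θ j u * q j u)) volume 0 τ := fun j =>
    ((hsub (hq j)).continuousOn_mul (by rw [uIcc_of_le hτ.1]; exact hθτ j)).neg
  have hsum : m ^ 2 ≤ ∑ j, θ j 0 ^ 2 + 2 * ∫ u in (0 : ℝ)..τ, ∑ j, -(θ j u * q j u) := by
    rw [hm, Real.sq_sqrt (Finset.sum_nonneg fun j _ => sq_nonneg _),
      intervalIntegral.integral_finsetSum fun j _ => hi2 j, Finset.mul_sum,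
      ← Finset.sum_add_distrib]
    exact Finset.sum_le_sum fun j _ => hj j
  have hle : ∫ u in (0 : ℝ)..τ, ∑ j, -(θ j u * q j u) ≤ m * ∫ u in (0 : ℝ)..T, G u := by
    have hs : IntervalIntegrable (fun u => ∑ j, -(θ j u * q j u)) volume 0 τ := by
      simpa only [Finset.sum_fn] using IntervalIntegrable.sum Finset.univ fun j _ => hi2 j
    calc ∫ u in (0 : ℝ)..τ, ∑ j, -(θ j u * q j u) ≤ ∫ u in (0 : ℝ)..τ, m * G u := by
          rw [intervalIntegral.integral_of_le hτ.1, intervalIntegral.integral_of_le hτ.1]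
          refine setIntegral_mono_on ((intervalIntegrable_iff_integrableOn_Ioc_of_le hτ.1).1 hs)
            ((intervalIntegrable_iff_integrableOn_Ioc_of_le hτ.1).1 ((hsub hG).const_mul m))
            measurableSet_Ioc fun u hu => ?_
          have hu' : u ∈ Ioc 0 T := ⟨hu.1, hu.2.trans hτ.2⟩
          have hcs := Real.sum_mul_le_sqrt_mul_sqrt Finset.univ (fun j => -θ j u) fun j => q j u
          simp only [neg_mul, neg_sq] at hcs
          refine hcs.trans ?_
          exact mul_le_mul (hmax u ⟨hu.1.le, hu'.2⟩) (hqG u hu') (Real.sqrt_nonneg _) hm0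
      _ = m * ∫ u in (0 : ℝ)..τ, G u := intervalIntegral.integral_const_mul _ _
      _ ≤ _ := by
          refine mul_le_mul_of_nonneg_left ?_ hm0
          rw [intervalIntegral.integral_of_le hT, intervalIntegral.integral_of_le hτ.1]
          refine setIntegral_mono_set ((intervalIntegrable_iff_integrableOn_Ioc_of_le hT).1 hG) ?_
            (Ioc_subset_Ioc_right hτ.2).eventuallyLE
          filter_upwards [ae_restrict_mem measurableSet_Ioc] with u hu
          exact hG0 u hu
  rcases hm0.eq_or_lt with h0 | h0
  · rw [← h0]
    have : 0 ≤ ∫ u in (0 : ℝ)..T, G u := by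
      rw [intervalIntegral.integral_of_le hT]
      exact setIntegral_nonneg measurableSet_Ioc hG0
    positivity
  have h5 := hmax 0 (left_mem_Icc.2 hT)
  have h6 : ∑ j, θ j 0 ^ 2 ≤ √(∑ j, θ j 0 ^ 2) * m := by
    rw [← Real.sq_sqrt (Finset.sum_nonneg fun j _ => sq_nonneg (θ j 0) :
      0 ≤ ∑ j, θ j 0 ^ 2), sq, Real.sqrt_mul_self (Real.sqrt_nonneg _)]
    exact mul_le_mul_of_nonneg_left h5 (Real.sqrt_nonneg _)
  refine le_of_mul_le_mul_right ?_ h0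
  nlinarith

end Energy

section Ritz

variable {H : Type*} [NormedAddCommGroup H] [InnerProductSpace ℝ H]
  {e : HilbertBasis ℕ ℝ H} {lam : ℕ → ℝ} {N : ℕ} {f : Fin N → H} {μ : Fin N → ℝ}

theorem HilbertBasis.inner_sum_smul (e : HilbertBasis ℕ ℝ H) (K : Finset ℕ) (v : ℕ → ℝ) (k : ℕ) :
    ⟪∑ i ∈ K, v i • (e i : H), e k⟫ = if k ∈ K then v k else 0 := by
  have h := orthonormal_iff_ite.1 e.orthonormal
  simp only [sum_inner, inner_smul_left, h, conj_trivial]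
  simp

theorem HilbertBasis.tsum_mul_inner_sum_smul_sq (e : HilbertBasis ℕ ℝ H) (K : Finset ℕ)
    (v w : ℕ → ℝ) : ∑' k, w k * ⟪∑ i ∈ K, v i • (e i : H), e k⟫ ^ 2 = ∑ k ∈ K, w k * v k ^ 2 := by
  simp only [e.inner_sum_smul]
  rw [tsum_eq_sum (s := K) fun k hk => by simp [hk]]
  exact Finset.sum_congr rfl fun k hk => by simp [hk]

theorem HilbertBasis.tsum_ofReal_inner_sum_smul_lt_top (e : HilbertBasis ℕ ℝ H) (K : Finset ℕ)
    (v w : ℕ → ℝ) :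
    ∑' k, ENNReal.ofReal (w k * ⟪∑ i ∈ K, v i • (e i : H), e k⟫ ^ 2) < ⊤ := by
  simp only [e.inner_sum_smul]
  rw [tsum_eq_sum (s := K) fun k hk => by simp [hk]]
  exact ENNReal.sum_lt_top.2 fun k _ => ENNReal.ofReal_lt_top

theorem summable_of_tsum_ofReal_lt_top {a : ℕ → ℝ} (ha : ∀ k, 0 ≤ a k)
    (h : ∑' k, ENNReal.ofReal (a k) < ⊤) : Summable a := by
  have := ENNReal.summable_toReal h.ne
  simpa only [ENNReal.toReal_ofReal (ha _)] using this

theorem FESetup.hasSum (hF : FESetup e lam N f μ) (hlam : ∀ k, 0 < lam k) (i j : Fin N) :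
    HasSum (fun k => lam k * ⟪f i, e k⟫ * ⟪f j, e k⟫) (if i = j then μ j else 0) := by
  have hs : ∀ j, Summable fun k => lam k * ⟪f j, e k⟫ ^ 2 := fun j =>
    summable_of_tsum_ofReal_lt_top (fun k => mul_nonneg (hlam k).le (sq_nonneg _)) (hF.f_dom j)
  have hsum : Summable fun k => lam k * ⟪f i, e k⟫ * ⟪f j, e k⟫ := by
    refine ((hs i).add (hs j)).of_norm_bounded fun k => ?_
    rw [Real.norm_eq_abs, mul_assoc, abs_mul, abs_of_pos (hlam k), ← mul_add]
    refine mul_le_mul_of_nonneg_left ?_ (hlam k).le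
    rw [abs_le]
    constructor <;> nlinarith [sq_nonneg (⟪f i, e k⟫ + ⟪f j, e k⟫),
      sq_nonneg (⟪f i, e k⟫ - ⟪f j, e k⟫), sq_nonneg ⟪f i, e k⟫, sq_nonneg ⟪f j, e k⟫]
  have h := hsum.hasSum
  rw [hF.eigen i j, orthonormal_iff_ite.1 hF.f_orth i j] at h
  by_cases hij : i = j
  · subst hij
    simpa using h
  · simpa [hij] using h

/-- Coefficients of the Ritz projection of a finite combination of eigenvectors. -/
theorem FESetup.inner_ritz (hF : FESetup e lam N f μ) (hlam : ∀ k, 0 < lam k) {Rh : H → H}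
    (hspan : ∀ v : H, Rh v ∈ Submodule.span ℝ (Set.range f))
    (horth : ∀ v : H, (∑' k, ENNReal.ofReal (lam k * ⟪v, e k⟫ ^ 2)) < ⊤ →
      ∀ j, (∑' k, lam k * ⟪Rh v - v, e k⟫ * ⟪f j, e k⟫) = 0)
    (K : Finset ℕ) (v : ℕ → ℝ) (j : Fin N) :
    ⟪f j, Rh (∑ k ∈ K, v k • (e k : H))⟫ = (∑ k ∈ K, lam k * v k * ⟪f j, e k⟫) / μ j := by
  set x : H := ∑ k ∈ K, v k • (e k : H) with hx
  obtain ⟨c, hc⟩ := (Submodule.mem_span_range_iff_exists_fun ℝ).1 (hspan x)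
  have h0 := horth x (e.tsum_ofReal_inner_sum_smul_lt_top K v lam) j
  have h1 : HasSum (fun k => ∑ i, c i * (lam k * ⟪f i, e k⟫ * ⟪f j, e k⟫))
      (∑ i, c i * (if i = j then μ j else 0)) :=
    hasSum_sum fun i _ => (hF.hasSum hlam i j).mul_left (c i)
  have h2 : HasSum (fun k => if k ∈ K then lam k * v k * ⟪f j, e k⟫ else 0)
      (∑ k ∈ K, lam k * v k * ⟪f j, e k⟫) := by
    have h : HasSum (fun k => if k ∈ K then lam k * v k * ⟪f j, e k⟫ else 0)
        (∑ k ∈ K, if k ∈ K then lam k * v k * ⟪f j, e k⟫ else 0) :=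
      hasSum_sum_of_ne_finset_zero fun k hk => by simp [hk]
    rwa [Finset.sum_congr rfl fun k hk => if_pos hk] at h
  have h3 := (h1.sub h2).tsum_eq
  have h4 : ∀ k, lam k * ⟪Rh x - x, e k⟫ * ⟪f j, e k⟫ =
      ∑ i, c i * (lam k * ⟪f i, e k⟫ * ⟪f j, e k⟫) -
        if k ∈ K then lam k * v k * ⟪f j, e k⟫ else 0 := by
    intro k
    rw [inner_sub_left, hx, e.inner_sum_smul, ← hx, ← hc, sum_inner, mul_sub, sub_mul,
      Finset.mul_sum, Finset.sum_mul]
    congr 1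
    · refine Finset.sum_congr rfl fun i _ => ?_
      rw [inner_smul_left, conj_trivial]; ring
    · split_ifs <;> simp
  simp only [h4] at h0
  rw [h3] at h0
  rw [← hc, hF.f_orth.inner_right_fintype, eq_div_iff (hF.mu_pos j).ne']
  simp only [mul_ite, mul_zero, Finset.sum_ite_eq', Finset.mem_univ, if_true] at h0
  linarith

end Ritz

section Galerkin

theorem sqrt_sum_sq_le_mul {ι : Type*} {K : Finset ι} {u v : ι → ℝ} {M : ℝ} (hM : 0 ≤ M)
    (h : ∀ k ∈ K, |u k| ≤ M * |v k|) : √(∑ k ∈ K, u k ^ 2) ≤ M * √(∑ k ∈ K, v k ^ 2) := by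
  refine Real.sqrt_le_iff.2 ⟨by positivity, ?_⟩
  rw [mul_pow, Real.sq_sqrt (Finset.sum_nonneg fun _ _ => sq_nonneg _), Finset.mul_sum]
  refine Finset.sum_le_sum fun k hk => ?_
  rw [← sq_abs (u k), ← sq_abs (v k), ← mul_pow]
  exact pow_le_pow_left₀ (abs_nonneg _) (h k hk) 2

variable {H : Type*} [NormedAddCommGroup H] [InnerProductSpace ℝ H]
  {e : HilbertBasis ℕ ℝ H} {lam : ℕ → ℝ} {N : ℕ} {f : Fin N → H} {μ : Fin N → ℝ}
  {b b' : ℝ → ℝ} {ρ : ℝ}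

theorem Orthonormal.norm_sum_smul {ι : Type*} {v : ι → H} (hv : Orthonormal ℝ v) (c : ι → ℝ)
    (K : Finset ι) : ‖∑ i ∈ K, c i • v i‖ = √(∑ i ∈ K, c i ^ 2) := by
  rw [← Real.sqrt_sq (norm_nonneg _), ← real_inner_self_eq_norm_sq, hv.inner_sum]
  simp [sq]

theorem Orthonormal.sqrt_sum_inner_sq_le {ι : Type*} {v : ι → H} (hv : Orthonormal ℝ v) (x : H)
    (K : Finset ι) : √(∑ i ∈ K, ⟪v i, x⟫ ^ 2) ≤ ‖x‖ := by
  rw [← Real.sqrt_sq (norm_nonneg x)]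
  refine Real.sqrt_le_sqrt ?_
  simpa using hv.sum_inner_products_le x (s := K)

/-- Linearity of the memory term along a finite combination of continuous functions. -/
theorem Assumption1.conv_sub_sum (hb : Assumption1 b b' ρ) {ι : Type*} (K : Finset ι)
    {g : ℝ → ℝ} {s : ι → ℝ → ℝ} (hg : ContinuousOn g (Ici 0))
    (hs : ∀ k, ContinuousOn (s k) (Ici 0)) (p : ℝ) (c : ι → ℝ) {t : ℝ} (ht : 0 ≤ t) :
    ∫ u in (0 : ℝ)..t, b (t - u) * (g u * p - ∑ k ∈ K, c k * s k u) =
      (∫ u in (0 : ℝ)..t, b (t - u) * g u) * p -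
        ∑ k ∈ K, c k * ∫ u in (0 : ℝ)..t, b (t - u) * s k u := by
  have h1 := (hb.intervalIntegrable_conv ht (hg.mono Icc_subset_Ici_self)).mul_const p
  have h2 : ∀ k ∈ K, IntervalIntegrable (fun u => c k * (b (t - u) * s k u)) volume 0 t :=
    fun k _ => (hb.intervalIntegrable_conv ht ((hs k).mono Icc_subset_Ici_self)).const_mul (c k)
  have h3 : IntervalIntegrable (fun u => ∑ k ∈ K, c k * (b (t - u) * s k u)) volume 0 t := by
    simpa only [Finset.sum_fn] using IntervalIntegrable.sum K h2
  rw [← intervalIntegral.integral_mul_const]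
  simp only [← intervalIntegral.integral_const_mul]
  rw [← intervalIntegral.integral_finsetSum h2, ← intervalIntegral.integral_sub h1 h3]
  refine intervalIntegral.integral_congr fun u _ => ?_
  simp only [mul_sub, Finset.mul_sum]
  congr 1
  · ring
  · exact Finset.sum_congr rfl fun k _ => by ring

/-- Semidiscrete error estimate for finite combinations of eigenvectors. -/
theorem FESetup.norm_error_le_of_finite (hF : FESetup e lam N f μ) (hb : Assumption1 b b' ρ)
    (hlam : ∀ k, 0 < lam k) {s s' : ℕ → ℝ → ℝ} (hs : ∀ k, IsScalarSolution b (lam k) (s k) (s' k))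
    {sh sh' : Fin N → ℝ → ℝ} (hsh : ∀ j, IsScalarSolution b (μ j) (sh j) (sh' j)) {Rh : H → H}
    (hspan : ∀ v : H, Rh v ∈ Submodule.span ℝ (Set.range f))
    (horth : ∀ v : H, (∑' k, ENNReal.ofReal (lam k * ⟪v, e k⟫ ^ 2)) < ⊤ →
      ∀ j, (∑' k, lam k * ⟪Rh v - v, e k⟫ * ⟪f j, e k⟫) = 0) {D : ℝ} (hD : 0 ≤ D)
    (hR : ∀ (K : Finset ℕ) (v : ℕ → ℝ), ‖Rh (∑ k ∈ K, v k • (e k : H)) -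
      ∑ k ∈ K, v k • (e k : H)‖ ≤ D * √(∑ k ∈ K, (lam k * v k) ^ 2))
    {T C α : ℝ} (hT : 0 < T) (hC : 0 ≤ C) (hα : 0 < α)
    (hs' : ∀ k, ∀ t ∈ Ioc 0 T, |s' k t| ≤ C * lam k ^ α * t ^ (α - 1)) (K : Finset ℕ) (ξ : ℕ → ℝ)
    {t : ℝ} (ht : t ∈ Icc 0 T) :
    ‖∑ k ∈ K, (s k t * ξ k) • (e k : H) -
        ∑ j, (sh j t * ⟪∑ k ∈ K, ξ k • (e k : H), f j⟫) • f j‖ ≤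
      2 * D * (√(∑ k ∈ K, (lam k * ξ k) ^ 2) +
        C * (T ^ α / α) * √(∑ k ∈ K, (lam k * (lam k ^ α * ξ k)) ^ 2)) := by
  set A := √(∑ k ∈ K, (lam k * ξ k) ^ 2) with hA
  set B := √(∑ k ∈ K, (lam k * (lam k ^ α * ξ k)) ^ 2) with hB
  set x : H := ∑ k ∈ K, ξ k • (e k : H) with hx
  set c : Fin N → ℕ → ℝ := fun j k => lam k * ξ k * ⟪f j, e k⟫ / μ j with hc
  have hritz : ∀ (g : ℕ → ℝ) j, ⟪f j, Rh (∑ k ∈ K, (g k * ξ k) • (e k : H))⟫ =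
      ∑ k ∈ K, c j k * g k := by
    intro g j
    rw [hF.inner_ritz hlam hspan horth K (fun k => g k * ξ k) j, Finset.sum_div]
    exact Finset.sum_congr rfl fun k _ => by simp only [hc]; ring
  have hinner : ∀ (g : ℕ → ℝ) j, ⟪f j, ∑ k ∈ K, (g k * ξ k) • (e k : H)⟫ =
      ∑ k ∈ K, ξ k * ⟪f j, e k⟫ * g k := by
    intro g j
    rw [inner_sum]
    exact Finset.sum_congr rfl fun k _ => by rw [inner_smul_right]; ring
  set θ : Fin N → ℝ → ℝ := fun j t => sh j t * ⟪x, f j⟫ - ∑ k ∈ K, c j k * s k t with hθ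
  set θ' : Fin N → ℝ → ℝ := fun j t => sh' j t * ⟪x, f j⟫ - ∑ k ∈ K, c j k * s' k t with hθ'
  set q : Fin N → ℝ → ℝ := fun j t =>
    ∑ k ∈ K, (c j k * s' k t - ξ k * ⟪f j, e k⟫ * s' k t) with hq
  have hsum_int : ∀ d : ℕ → ℝ, IntervalIntegrable (fun t => ∑ k ∈ K, d k * s' k t) volume 0 T := by
    intro d
    simpa only [Finset.sum_fn] using IntervalIntegrable.sum K fun k _ =>
      ((hs k).intervalIntegrable_deriv hb (hlam k) hT.le).const_mul (d k)
  have hsqrt : ∀ {g : ℕ → ℝ} {M : ℝ}, 0 ≤ M → ∀ w : ℕ → ℝ, (∀ k ∈ K, |g k| ≤ M * |w k|) →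
      √(∑ k ∈ K, (lam k * (g k * ξ k)) ^ 2) ≤ M * √(∑ k ∈ K, (lam k * (w k * ξ k)) ^ 2) := by
    intro g M hM w hg
    refine sqrt_sum_sq_le_mul hM fun k hk => ?_
    have h := mul_le_mul_of_nonneg_right (hg k hk) (abs_nonneg (lam k * ξ k))
    rw [abs_mul, abs_mul, abs_mul, abs_mul, mul_left_comm, mul_left_comm |lam k|, ← abs_mul (lam k)]
    exact h.trans_eq (mul_assoc _ _ _)
  have hbessel : ∀ g : ℕ → ℝ, √(∑ j, (∑ k ∈ K, (c j k * g k - ξ k * ⟪f j, e k⟫ * g k)) ^ 2) ≤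
      D * √(∑ k ∈ K, (lam k * (g k * ξ k)) ^ 2) := by
    intro g
    refine le_trans ?_ (hR K fun k => g k * ξ k)
    simp only [Finset.sum_sub_distrib, ← hritz, ← hinner, ← inner_sub_right]
    exact hF.f_orth.sqrt_sum_inner_sq_le _ _
  have hG : IntervalIntegrable (fun t => D * (C * t ^ (α - 1) * B)) volume 0 T :=
    (((intervalIntegral.intervalIntegrable_rpow' (by linarith)).const_mul C).mul_const B).const_mul D
  have hen := hb.energy_estimate (μ := μ) hF.mu_pos (θ := θ) (θ' := θ') (q := q) hT.le
    (fun j => (((hsh j).cont.mono Icc_subset_Ici_self).mul_const _).sub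
      (continuousOn_finsetSum _ fun k _ => ((hs k).cont.mono Icc_subset_Ici_self).const_mul _))
    (fun j t ht => (((hsh j).hasDeriv t ht).mul_const _).sub
      (HasDerivAt.fun_sum fun k _ => ((hs k).hasDeriv t ht).const_mul _))
    (fun j => (((hsh j).intervalIntegrable_deriv hb (hF.mu_pos j) hT.le).mul_const _).sub
      (hsum_int (c j)))
    (fun j => by
      have := (hsum_int (c j)).sub (hsum_int fun k => ξ k * ⟪f j, e k⟫)
      refine this.congr fun t _ => ?_
      simp only [hq, Finset.sum_sub_distrib])
    (fun j t ht => by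
      rw [hb.conv_sub_sum K (hsh j).cont (fun k => (hs k).cont) _ _ (le_of_lt ht)]
      simp only [hθ', hq, (hsh j).deriv_eq ht, mul_sub, Finset.mul_sum, Finset.sum_sub_distrib]
      have : ∀ k ∈ K, μ j * (c j k * ∫ u in (0 : ℝ)..t, b (t - u) * s k u) =
          -(ξ k * ⟪f j, e k⟫ * s' k t) := fun k _ => by
        have := (hF.mu_pos j).ne'
        rw [(hs k).deriv_eq ht]
        simp only [hc]
        field_simp
      rw [Finset.sum_congr rfl this, Finset.sum_neg_distrib]
      ring)
    hG
    (fun t ht => by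
      have := Real.rpow_nonneg ht.1.le (α - 1)
      positivity)
    (fun t ht => by
      have h0 := Real.rpow_nonneg ht.1.le (α - 1)
      refine (hbessel fun k => s' k t).trans (mul_le_mul_of_nonneg_left ?_ hD)
      refine hsqrt (by positivity) (fun k => lam k ^ α) fun k _ => ?_
      rw [abs_of_nonneg (Real.rpow_nonneg (hlam k).le α)]
      exact (hs' k t ht).trans_eq (by ring))
    ht
  have hθ0 : √(∑ j, θ j 0 ^ 2) ≤ D * A := by
    have := hbessel fun _ => 1
    simp only [mul_one, one_mul] at this
    refine le_trans (le_of_eq ?_) this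
    congr 1
    refine Finset.sum_congr rfl fun j _ => ?_
    have h1 := hinner (fun _ => 1) j
    simp only [mul_one, one_mul] at h1
    simp only [hθ, (hsh j).init, (hs _).init, one_mul, mul_one, Finset.sum_sub_distrib, ← h1]
    rw [← hx, real_inner_comm x]
    ring
  have hint : ∫ u in (0 : ℝ)..T, D * (C * u ^ (α - 1) * B) = D * (C * (T ^ α / α) * B) := by
    rw [intervalIntegral.integral_const_mul, intervalIntegral.integral_mul_const,
      intervalIntegral.integral_const_mul, integral_rpow (Or.inl (by linarith))]
    simp [Real.zero_rpow hα.ne']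
  rw [hint] at hen
  set u : H := ∑ k ∈ K, (s k t * ξ k) • (e k : H) with hu
  have hRu : Rh u = ∑ j, (∑ k ∈ K, c j k * s k t) • f j := by
    obtain ⟨d, hd⟩ := (Submodule.mem_span_range_iff_exists_fun ℝ).1 (hspan u)
    rw [← hd]
    refine Finset.sum_congr rfl fun j _ => ?_
    rw [← hritz, ← hu, ← hd, hF.f_orth.inner_right_fintype]
  have hθt : ‖Rh u - ∑ j, (sh j t * ⟪x, f j⟫) • f j‖ = √(∑ j, θ j t ^ 2) := by
    rw [hRu, norm_sub_rev, ← Finset.sum_sub_distrib]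
    simp only [← sub_smul]
    exact hF.f_orth.norm_sum_smul _ _
  have h1 : ‖Rh u - u‖ ≤ D * A := by
    refine (hR K fun k => s k t * ξ k).trans (mul_le_mul_of_nonneg_left ?_ hD)
    have := hsqrt (g := fun k => s k t) zero_le_one (fun _ => 1) fun k _ => by
      simpa using (hs k).abs_le_one hb (hlam k) ht.1
    simpa using this
  have h2 : u - ∑ j, (sh j t * ⟪x, f j⟫) • f j =
      (Rh u - ∑ j, (sh j t * ⟪x, f j⟫) • f j) - (Rh u - u) := by abel
  rw [h2]
  refine (norm_sub_le _ _).trans ?_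
  rw [hθt]
  linarith

end Galerkin

section Splitting

variable {H : Type*} [NormedAddCommGroup H] [InnerProductSpace ℝ H]

theorem Orthonormal.norm_sum_mul_inner_smul_le {ι : Type*} {v : ι → H} (hv : Orthonormal ℝ v)
    {m : ι → ℝ} (hm : ∀ i, |m i| ≤ 1) (x : H) (K : Finset ι) :
    ‖∑ i ∈ K, (m i * ⟪x, v i⟫) • v i‖ ≤ ‖x‖ := by
  rw [hv.norm_sum_smul]
  refine le_trans (Real.sqrt_le_sqrt (Finset.sum_le_sum fun i _ => ?_))
    (hv.sqrt_sum_inner_sq_le x K)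
  rw [mul_pow, real_inner_comm]
  exact mul_le_of_le_one_left (sq_nonneg _) ((sq_le_one_iff_abs_le_one _).2 (hm i))

theorem HilbertBasis.hasSum_inner_sq (e : HilbertBasis ℕ ℝ H) (x : H) :
    HasSum (fun k => ⟪x, e k⟫ ^ 2) (‖x‖ ^ 2) := by
  have h := e.hasSum_inner_mul_inner x x
  rw [real_inner_self_eq_norm_sq] at h
  refine h.congr_fun fun k => ?_
  rw [real_inner_comm x, sq]

theorem HilbertBasis.summable_mul_inner_smul [CompleteSpace H] (e : HilbertBasis ℕ ℝ H)
    {m : ℕ → ℝ} (hm : ∀ k, |m k| ≤ 1) (x : H) :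
    Summable fun k => (m k * ⟪x, e k⟫) • (e k : H) := by
  have hf : Memℓp (fun k => m k * ⟪x, e k⟫) 2 := by
    refine memℓp_gen ?_
    refine Summable.of_nonneg_of_le (fun k => by positivity) (fun k => ?_)
      (e.hasSum_inner_sq x).summable
    simp only [ENNReal.toReal_ofNat, Real.rpow_ofNat, Real.norm_eq_abs, sq_abs, mul_pow]
    exact mul_le_of_le_one_left (sq_nonneg _) ((sq_le_one_iff_abs_le_one _).2 (hm k))
  exact (e.hasSum_repr_symm ⟨_, hf⟩).summable

theorem Sop_add [CompleteSpace H] (e : HilbertBasis ℕ ℝ H) {s : ℕ → ℝ → ℝ} {t : ℝ}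
    (hs : ∀ k, |s k t| ≤ 1) (x y : H) : Sop e s t (x + y) = Sop e s t x + Sop e s t y := by
  simp only [Sop]
  rw [← (e.summable_mul_inner_smul hs x).tsum_add (e.summable_mul_inner_smul hs y)]
  simp only [inner_add_left, mul_add, add_smul]

theorem Sop_sum_smul (e : HilbertBasis ℕ ℝ H) (s : ℕ → ℝ → ℝ) (t : ℝ) (K : Finset ℕ)
    (v : ℕ → ℝ) : Sop e s t (∑ k ∈ K, v k • (e k : H)) = ∑ k ∈ K, (s k t * v k) • (e k : H) := by
  simp only [Sop, e.inner_sum_smul]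
  rw [tsum_eq_sum (s := K) fun k hk => by simp [hk]]
  exact Finset.sum_congr rfl fun k hk => by simp [hk]

theorem norm_Sop_le [CompleteSpace H] (e : HilbertBasis ℕ ℝ H) {s : ℕ → ℝ → ℝ} {t : ℝ}
    (hs : ∀ k, |s k t| ≤ 1) (x : H) : ‖Sop e s t x‖ ≤ ‖x‖ :=
  le_of_tendsto (e.summable_mul_inner_smul hs x).hasSum.norm
    (Eventually.of_forall fun K => e.orthonormal.norm_sum_mul_inner_smul_le hs x K)

theorem rpow_le_mul_rpow_of_le {a l p r : ℝ} (ha : 0 < a) (hl : a ≤ l) (hpr : p ≤ r) :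
    l ^ p ≤ a ^ (p - r) * l ^ r := by
  have hl0 := ha.trans_le hl
  calc l ^ p = l ^ (p - r) * l ^ r := by rw [← Real.rpow_add hl0]; ring_nf
    _ ≤ _ := mul_le_mul_of_nonneg_right
      (Real.rpow_le_rpow_of_nonpos ha hl (by linarith)) (Real.rpow_nonneg hl0.le _)

/-- Splitting at a frequency threshold: the part of `x` above the threshold is small. -/
theorem HilbertBasis.norm_sub_sum_le (e : HilbertBasis ℕ ℝ H) {w : ℕ → ℝ} (hw : ∀ k, 0 ≤ w k)
    {x : H} (hx : Summable fun k => w k * ⟪x, e k⟫ ^ 2) {K : Finset ℕ} {a : ℝ} (ha : 0 ≤ a)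
    (hK : ∀ k ∉ K, 1 ≤ a ^ 2 * w k) :
    ‖x - ∑ k ∈ K, ⟪x, e k⟫ • (e k : H)‖ ≤ a * √(∑' k, w k * ⟪x, e k⟫ ^ 2) := by
  set y := x - ∑ k ∈ K, ⟪x, e k⟫ • (e k : H) with hy
  rw [← Real.sqrt_sq (norm_nonneg y), ← Real.sqrt_sq ha, ← Real.sqrt_mul (sq_nonneg _)]
  refine Real.sqrt_le_sqrt (hasSum_le (fun k => ?_) (e.hasSum_inner_sq y) (hx.hasSum.mul_left _))
  rw [hy, inner_sub_left, e.inner_sum_smul K (fun k => ⟪x, e k⟫)]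
  split_ifs with hk
  · rw [sub_self, zero_pow two_ne_zero]
    have := hw k
    positivity
  · rw [sub_zero, ← mul_assoc]
    exact le_mul_of_one_le_left (sq_nonneg _) (hK k hk)

theorem HilbertBasis.norm_ritz_sum_sub_le (e : HilbertBasis ℕ ℝ H) {lam : ℕ → ℝ} {Rh : H → H} {D : ℝ}
    (hR : ∀ v : H, (∑' k, ENNReal.ofReal (lam k ^ (2 : ℝ) * ⟪v, e k⟫ ^ 2)) < ⊤ →
      ‖Rh v - v‖ ≤ D * √(∑' k, lam k ^ (2 : ℝ) * ⟪v, e k⟫ ^ 2)) (K : Finset ℕ) (v : ℕ → ℝ) :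
    ‖Rh (∑ k ∈ K, v k • (e k : H)) - ∑ k ∈ K, v k • (e k : H)‖ ≤
      D * √(∑ k ∈ K, (lam k * v k) ^ 2) := by
  have h := hR _ (e.tsum_ofReal_inner_sum_smul_lt_top K v fun k => lam k ^ (2 : ℝ))
  rw [e.tsum_mul_inner_sum_smul_sq K v fun k => lam k ^ (2 : ℝ)] at h
  simpa only [Real.rpow_ofNat, mul_pow] using h

end Splitting

/-- the pointwise smooth data error estimate for the spatially
semidiscrete deterministic problem:
`‖S(t)x - S_h(t)P_h x‖ ≤ C h^s ‖x‖_{s(1+ε)}` for `0 ≤ s ≤ 2`, `t ∈ [0,T]`,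
with `C = C(T,ε)` independent of `h` and `x` (given the Ritz error constant `CR`). -/
theorem statement9 {H : Type*} [NormedAddCommGroup H] [InnerProductSpace ℝ H]
    [CompleteSpace H]
    (b b' : ℝ → ℝ) (ρ : ℝ) (hb : Assumption1 b b' ρ)
    (e : HilbertBasis ℕ ℝ H) (lam : ℕ → ℝ)
    (hlam_pos : ∀ k, 0 < lam k) (hlam_mono : Monotone lam)
    (hlam_top : Tendsto lam atTop atTop)
    (s s' : ℕ → ℝ → ℝ) (hs : ∀ k, IsScalarSolution b (lam k) (s k) (s' k))
    (CR : ℝ) (hCR : 0 < CR) (ε T : ℝ) (hε : 0 < ε) (hT : 0 < T) :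
    ∃ C > 0, ∀ h : ℝ, 0 < h →
      ∀ (N : ℕ) (f : Fin N → H) (μ : Fin N → ℝ), FESetup e lam N f μ →
      ∀ Rh : H → H,
        (∀ v : H, Rh v ∈ Submodule.span ℝ (Set.range f)) →
        (∀ v : H, (∑' k, ENNReal.ofReal (lam k * ⟪v, e k⟫ ^ 2)) < ⊤ →
          ∀ j, (∑' k, lam k * ⟪Rh v - v, e k⟫ * ⟪f j, e k⟫) = 0) →
        (∀ γ ∈ Set.Icc (1 : ℝ) 2, ∀ v : H,
          (∑' k, ENNReal.ofReal (lam k ^ γ * ⟪v, e k⟫ ^ 2)) < ⊤ →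
          ‖Rh v - v‖ ≤ CR * h ^ γ * Real.sqrt (∑' k, lam k ^ γ * ⟪v, e k⟫ ^ 2)) →
      ∀ sh sh' : Fin N → ℝ → ℝ, (∀ j, IsScalarSolution b (μ j) (sh j) (sh' j)) →
      ∀ σ ∈ Set.Icc (0 : ℝ) 2, ∀ t ∈ Set.Icc (0 : ℝ) T, ∀ x : H,
        (∑' k, ENNReal.ofReal (lam k ^ (σ * (1 + ε)) * ⟪x, e k⟫ ^ 2)) < ⊤ →
        ‖Sop e s t x - ∑ j, (sh j t * ⟪x, f j⟫) • f j‖ ≤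
          C * h ^ σ * Real.sqrt (∑' k, lam k ^ (σ * (1 + ε)) * ⟪x, e k⟫ ^ 2) := by
  have hε' : 0 < min ε 1 := lt_min hε one_pos
  set α := min ε 1 with hα
  obtain ⟨C₁, hC₁, hs'⟩ := hb.exists_abs_deriv_le hε' (min_le_right ε 1) hT
  have hl0 := hlam_pos 0
  have hle : ∀ k, lam 0 ≤ lam k := fun k => hlam_mono (Nat.zero_le k)
  set M := lam 0 ^ (-ε) + C₁ * (T ^ α / α) * lam 0 ^ (α - ε) with hM
  have hM0 : 0 < M := by positivity
  refine ⟨2 * CR * M + 2, by positivity, fun h hh N f μ hF Rh hspan horth hritz sh sh' hsh σ hσ t ht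
    x hx => ?_⟩
  have hβ : 0 < 1 + ε := by linarith
  set W := √(∑' k, lam k ^ (σ * (1 + ε)) * ⟪x, e k⟫ ^ 2) with hW
  have hw : ∀ k, 0 ≤ lam k ^ (σ * (1 + ε)) := fun k => Real.rpow_nonneg (hlam_pos k).le _
  have hxs := summable_of_tsum_ofReal_lt_top (fun k => mul_nonneg (hw k) (sq_nonneg _)) hx
  have hfin : {k | lam k ^ (1 + ε) * h ^ 2 < 1}.Finite := by
    have h1 := ((tendsto_rpow_atTop hβ).comp hlam_top).atTop_mul_const (pow_pos hh 2)
    have h2 := h1.eventually_ge_atTop 1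
    rw [← Nat.cofinite_eq_atTop, eventually_cofinite] at h2
    simpa only [not_le, Function.comp_apply] using h2
  set K := hfin.toFinset with hK
  have hz : ∀ k, (lam k ^ (1 + ε) * h ^ 2) ^ σ = (h ^ σ) ^ 2 * lam k ^ (σ * (1 + ε)) := by
    intro k
    rw [Real.mul_rpow (Real.rpow_nonneg (hlam_pos k).le _) (sq_nonneg h),
      ← Real.rpow_mul (hlam_pos k).le, ← Real.rpow_natCast, ← Real.rpow_natCast,
      ← Real.rpow_mul hh.le, ← Real.rpow_mul hh.le, mul_comm, mul_comm σ (1 + ε),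
      mul_comm σ ((2 : ℕ) : ℝ)]
  have hhσ : 0 ≤ h ^ σ := Real.rpow_nonneg hh.le _
  set xl : H := ∑ k ∈ K, ⟪x, e k⟫ • (e k : H) with hxl
  have hhigh : ‖x - xl‖ ≤ h ^ σ * W := by
    refine e.norm_sub_sum_le hw hxs hhσ fun k hk => ?_
    rw [hK, Set.Finite.mem_toFinset, Set.mem_ofPred_eq, not_lt] at hk
    rw [← hz]
    exact Real.one_le_rpow hk hσ.1
  have hV : h ^ 2 * √(∑ k ∈ K, (lam k ^ (1 + ε) * ⟪x, e k⟫) ^ 2) ≤ h ^ σ * W := by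
    rw [← Real.sqrt_sq (sq_nonneg h), ← Real.sqrt_sq hhσ, ← Real.sqrt_mul (sq_nonneg _),
      hW, ← Real.sqrt_mul (sq_nonneg _)]
    refine Real.sqrt_le_sqrt (le_trans ?_ (mul_le_mul_of_nonneg_left
      (hxs.sum_le_tsum K fun k _ => mul_nonneg (hw k) (sq_nonneg _)) (sq_nonneg _)))
    rw [Finset.mul_sum, Finset.mul_sum]
    refine Finset.sum_le_sum fun k hk => ?_
    rw [hK, Set.Finite.mem_toFinset, Set.mem_ofPred_eq] at hk
    have hz0 : 0 < lam k ^ (1 + ε) * h ^ 2 := by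
      have := hlam_pos k
      positivity
    have h1 := Real.rpow_le_rpow_of_exponent_ge hz0 hk.le hσ.2
    rw [hz, Real.rpow_ofNat] at h1
    calc (h ^ 2) ^ 2 * (lam k ^ (1 + ε) * ⟪x, e k⟫) ^ 2 =
          (lam k ^ (1 + ε) * h ^ 2) ^ 2 * ⟪x, e k⟫ ^ 2 := by ring
      _ ≤ (h ^ σ) ^ 2 * lam k ^ (σ * (1 + ε)) * ⟪x, e k⟫ ^ 2 :=
        mul_le_mul_of_nonneg_right h1 (sq_nonneg _)
      _ = _ := mul_assoc _ _ _
  have hlow := hF.norm_error_le_of_finite hb hlam_pos hs hsh hspan horth (D := CR * h ^ 2)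
    (by positivity) (e.norm_ritz_sum_sub_le fun v hv => by
      simpa only [Real.rpow_ofNat] using hritz 2 ⟨one_le_two, le_rfl⟩ v hv) hT hC₁.le hε'
    (fun k => hs' _ (hlam_pos k) _ _ (hs k)) K (fun k => ⟪x, e k⟫) ht
  set V := √(∑ k ∈ K, (lam k ^ (1 + ε) * ⟪x, e k⟫) ^ 2)
  have hA : √(∑ k ∈ K, (lam k * ⟪x, e k⟫) ^ 2) ≤ lam 0 ^ (-ε) * V := by
    refine sqrt_sum_sq_le_mul (by positivity) fun k _ => ?_
    have h1 := rpow_le_mul_rpow_of_le hl0 (hle k) (p := 1) (r := 1 + ε) (by linarith)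
    rw [Real.rpow_one, show 1 - (1 + ε) = -ε by ring] at h1
    rw [abs_mul, abs_mul, ← mul_assoc, abs_of_pos (hlam_pos k),
      abs_of_nonneg (Real.rpow_nonneg (hlam_pos k).le _)]
    exact mul_le_mul_of_nonneg_right h1 (abs_nonneg _)
  have hB : √(∑ k ∈ K, (lam k * (lam k ^ α * ⟪x, e k⟫)) ^ 2) ≤ lam 0 ^ (α - ε) * V := by
    refine sqrt_sum_sq_le_mul (by positivity) fun k _ => ?_
    have h1 := rpow_le_mul_rpow_of_le hl0 (hle k) (p := 1 + α) (r := 1 + ε)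
      (by linarith [min_le_left ε 1])
    rw [Real.rpow_one_add' (hlam_pos k).le (by positivity),
      show 1 + α - (1 + ε) = α - ε by ring] at h1
    rw [← mul_assoc, abs_mul, abs_mul (lam k ^ (1 + ε)), ← mul_assoc,
      abs_of_nonneg (mul_nonneg (hlam_pos k).le (Real.rpow_nonneg (hlam_pos k).le _)),
      abs_of_nonneg (Real.rpow_nonneg (hlam_pos k).le _)]
    exact mul_le_mul_of_nonneg_right h1 (abs_nonneg _)
  have hlow' : ‖Sop e s t xl - ∑ j, (sh j t * ⟪xl, f j⟫) • f j‖ ≤ 2 * CR * M * (h ^ σ * W) := by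
    rw [hxl, Sop_sum_smul]
    refine hlow.trans ?_
    calc 2 * (CR * h ^ 2) * (√(∑ k ∈ K, (lam k * ⟪x, e k⟫) ^ 2) +
          C₁ * (T ^ α / α) * √(∑ k ∈ K, (lam k * (lam k ^ α * ⟪x, e k⟫)) ^ 2)) ≤
          2 * (CR * h ^ 2) * (lam 0 ^ (-ε) * V + C₁ * (T ^ α / α) * (lam 0 ^ (α - ε) * V)) :=
        mul_le_mul_of_nonneg_left
          (add_le_add hA (mul_le_mul_of_nonneg_left hB (by positivity))) (by positivity)
      _ = 2 * CR * M * (h ^ 2 * V) := by rw [hM]; ring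
      _ ≤ _ := mul_le_mul_of_nonneg_left hV (by positivity)
  have hs1 : ∀ k, |s k t| ≤ 1 := fun k => (hs k).abs_le_one hb (hlam_pos k) ht.1
  have hsplit : Sop e s t x - ∑ j, (sh j t * ⟪x, f j⟫) • f j =
      (Sop e s t xl - ∑ j, (sh j t * ⟪xl, f j⟫) • f j) +
        (Sop e s t (x - xl) - ∑ j, (sh j t * ⟪x - xl, f j⟫) • f j) := by
    have h1 := Sop_add e hs1 xl (x - xl)
    rw [add_sub_cancel] at h1
    rw [h1]
    simp only [inner_sub_left, mul_sub, sub_smul, Finset.sum_sub_distrib]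
    abel
  have hd := (norm_sub_le (Sop e s t (x - xl)) (∑ j, (sh j t * ⟪x - xl, f j⟫) • f j)).trans
    (add_le_add (norm_Sop_le e hs1 _) (hF.f_orth.norm_sum_mul_inner_smul_le
      (fun j => (hsh j).abs_le_one hb (hF.mu_pos j) ht.1) _ _))
  rw [hsplit]
  refine (norm_add_le _ _).trans ?_
  linarith
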